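/- arXiv:math/0404075 — 2 statements merged into one kernel-verified Lean document; each statement's English description precedes it below -/
import Mathlib

section
/- Let G be a finitely generated group with ω(G) = 1 (zero algebraic entropy) and let H be a normal subgroup of G such that the quotient group G/H is elementary amenable. Then H is finitely generated. -/
section GrowthDefs

variable {G : Type*} [Group G]

/-- The ball of radius `n` w.r.t. a finite set `X`: all elements of `G` that are products
of at most `n` letters from `X ∪ X⁻¹`. -/
def wordBall (X : Finset G) (n : ℕ) : Set G :=
  {g | ∃ l : List G, l.length ≤ n ∧ (∀ x ∈ l, x ∈ X ∨ x⁻¹ ∈ X) ∧ l.prod = g}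

/-- The growth function `γ_G^X(n) = card {g ∈ G : ‖g‖_X ≤ n}`. -/
noncomputable def growthFn (X : Finset G) (n : ℕ) : ℕ :=
  Nat.card (wordBall X n)

/-- The exponential growth rate `ω(G,X) = lim_{n→∞} γ_G^X(n)^{1/n}`, which by
submultiplicativity of the growth function equals `inf_{n ≥ 1} γ_G^X(n)^{1/n}`. -/
noncomputable def growthRateX (X : Finset G) : ℝ :=
  ⨅ n : ℕ, (growthFn X (n + 1) : ℝ) ^ ((1 : ℝ) / (n + 1))

/-- The minimal exponential growth rate `ω(G) = inf_X ω(G,X)`, the infimum being taken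
over all finite generating sets `X` of `G`. -/
noncomputable def minGrowthRate (G : Type*) [Group G] : ℝ :=
  sInf {r : ℝ | ∃ X : Finset G, Subgroup.closure (X : Set G) = ⊤ ∧ r = growthRateX X}

/-- `G` has exponential growth: `ω(G,X) > 1` for some (equivalently, every) finite
generating set `X`. -/
def HasExponentialGrowth (G : Type*) [Group G] : Prop :=
  ∃ X : Finset G, Subgroup.closure (X : Set G) = ⊤ ∧ 1 < growthRateX X

end GrowthDefs

universe u

/-- The class `EG` of elementary amenable groups: the smallest class of groups containing
all abelian groups and all finite groups and closed under taking subgroups, taking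
quotient groups, group extensions and direct limits (directed unions). -/
inductive ElementaryAmenable : (G : Type u) → Group G → Prop
  | abelian (G : Type u) [inst : Group G] (h : ∀ a b : G, a * b = b * a) :
      ElementaryAmenable G inst
  | finite (G : Type u) [inst : Group G] (h : Finite G) : ElementaryAmenable G inst
  | subgroup {G H : Type u} [instG : Group G] [instH : Group H] (f : H →* G)
      (hf : Function.Injective f) (hG : ElementaryAmenable G instG) :
      ElementaryAmenable H instH
  | quotient {G H : Type u} [instG : Group G] [instH : Group H] (f : G →* H)
      (hf : Function.Surjective f) (hG : ElementaryAmenable G instG) :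
      ElementaryAmenable H instH
  | extension {G : Type u} [instG : Group G] (N : Subgroup G) [hN : N.Normal]
      (h1 : ElementaryAmenable N inferInstance)
      (h2 : ElementaryAmenable (G ⧸ N) inferInstance) :
      ElementaryAmenable G instG
  | directedUnion {G : Type u} [instG : Group G] {ι : Type u} (K : ι → Subgroup G)
      (hdir : Directed (· ≤ ·) K) (htop : ⨆ i, K i = ⊤)
      (h : ∀ i, ElementaryAmenable (K i) inferInstance) :
      ElementaryAmenable G instG

open scoped Pointwise commutatorElement

/-- A finite symmetric generating set containing `1` for which, for some `n`, the ball of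
radius `k * n` has fewer than `2 ^ n` elements. -/
structure IsSlowGenSet {G : Type*} [Group G] (k : ℕ) (S : Set G) : Prop where
  finite : S.Finite
  one_mem : (1 : G) ∈ S
  inv_mem : ∀ x ∈ S, x⁻¹ ∈ S
  closure_eq : Subgroup.closure S = ⊤
  slow : ∃ n : ℕ, (S ^ (k * n)).ncard < 2 ^ n

/-- A convenient form of `ω(G) = 1`. -/
def HasSlowGenSets (G : Type*) [Group G] : Prop :=
  ∀ k : ℕ, ∃ S : Set G, IsSlowGenSet k S

theorem Set.Finite.pow_of_group {G : Type*} [Group G] {S : Set G} (hS : S.Finite) (n : ℕ) :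
    (S ^ n).Finite := by
  induction n with
  | zero => simp
  | succ n ih => rw [pow_succ]; exact ih.mul hS

theorem Set.inv_mem_pow {G : Type*} [Group G] {S : Set G} (hS : ∀ x ∈ S, x⁻¹ ∈ S) {n : ℕ} :
    ∀ x ∈ S ^ n, x⁻¹ ∈ S ^ n := by
  have h : S⁻¹ = S := by
    ext x
    exact ⟨fun hx => inv_inv x ▸ hS _ hx, fun hx => hS _ hx⟩
  intro x hx
  rw [← h, inv_pow]
  simpa using hx

theorem IsSlowGenSet.mono {G : Type*} [Group G] {k k' : ℕ} {S : Set G} (h : IsSlowGenSet k S)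
    (hk : k' ≤ k) : IsSlowGenSet k' S := by
  refine ⟨h.finite, h.one_mem, h.inv_mem, h.closure_eq, ?_⟩
  obtain ⟨n, hn⟩ := h.slow
  exact ⟨n, (Set.ncard_le_ncard (Set.pow_subset_pow_right h.one_mem (Nat.mul_le_mul_right n hk))
    (h.finite.pow_of_group _)).trans_lt hn⟩

/-- Two short elements satisfy a nontrivial relation between positive words of the same length. -/
theorem IsSlowGenSet.exists_collision {G : Type*} [Group G] {k : ℕ} {S : Set G}
    (h : IsSlowGenSet k S) {a b : G} (ha : a ∈ S ^ k) (hb : b ∈ S ^ k) :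
    ∃ l l' : List Bool, l.length = l'.length ∧ l ≠ l' ∧
      (l.map fun e => cond e a b).prod = (l'.map fun e => cond e a b).prod := by
  obtain ⟨n, hn⟩ := h.slow
  by_contra! hne
  have hmem : ∀ l : List Bool, (l.map fun e => cond e a b).prod ∈ S ^ (k * l.length) := by
    intro l
    induction l with
    | nil => simp
    | cons e l ih =>
      rw [List.map_cons, List.prod_cons, List.length_cons, Nat.mul_succ, add_comm, pow_add]
      refine Set.mul_mem_mul ?_ ih
      cases e <;> assumption
  have : Finite ↥(S ^ (k * n)) := h.finite.pow_of_group _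
  let f : List.Vector Bool n → ↥(S ^ (k * n)) := fun v =>
    ⟨(v.1.map fun e => cond e a b).prod, by have := hmem v.1; rwa [v.2] at this⟩
  have hf : Function.Injective f := by
    intro v w hvw
    by_contra hne'
    exact hne v.1 w.1 (v.2.trans w.2.symm) (fun hh => hne' (Subtype.ext hh))
      (congrArg Subtype.val hvw)
  have h1 := Nat.card_le_card_of_injective f hf
  rw [Nat.card_eq_fintype_card, card_vector, Fintype.card_bool] at h1
  have : (S ^ (k * n)).ncard = Nat.card ↥(S ^ (k * n)) := rfl
  omega

theorem HasSlowGenSets.of_surjective {G Q : Type*} [Group G] [Group Q] (h : HasSlowGenSets G)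
    (f : G →* Q) (hf : Function.Surjective f) : HasSlowGenSets Q := by
  intro k
  obtain ⟨S, hS⟩ := h k
  refine ⟨f '' S, hS.finite.image f, ⟨1, hS.one_mem, map_one f⟩, ?_, ?_, ?_⟩
  · rintro _ ⟨x, hx, rfl⟩
    exact ⟨x⁻¹, hS.inv_mem x hx, map_inv f x⟩
  · rw [← MonoidHom.map_closure, hS.closure_eq, Subgroup.map_top_of_surjective f hf]
  · obtain ⟨n, hn⟩ := hS.slow
    refine ⟨n, lt_of_le_of_lt ?_ hn⟩
    rw [← Set.image_pow]
    exact Set.ncard_image_le (hS.finite.pow_of_group _)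

theorem HasSlowGenSets.fg {G : Type*} [Group G] (h : HasSlowGenSets G) : Group.FG G := by
  obtain ⟨S, hS⟩ := h 0
  exact Group.fg_iff.2 ⟨S, hS.closure_eq, hS.finite⟩

theorem Set.exists_mem_pow_of_closure_eq_top {G : Type*} [Group G] {S : Set G}
    (hinv : ∀ x ∈ S, x⁻¹ ∈ S) (hS : Subgroup.closure S = ⊤) (g : G) :
    ∃ n, g ∈ S ^ n := by
  have hg : g ∈ Subgroup.closure S := hS ▸ Subgroup.mem_top g
  induction hg using Subgroup.closure_induction with
  | mem x hx => exact ⟨1, by simpa⟩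
  | one => exact ⟨0, by simp⟩
  | mul x y _ _ hx hy =>
    obtain ⟨n, hn⟩ := hx
    obtain ⟨m, hm⟩ := hy
    exact ⟨n + m, pow_add S n m ▸ Set.mul_mem_mul hn hm⟩
  | inv x _ hx =>
    obtain ⟨n, hn⟩ := hx
    exact ⟨n, Set.inv_mem_pow hinv x hn⟩

theorem HasSlowGenSets.subgroup {G : Type*} [Group G] (h : HasSlowGenSets G) (K : Subgroup G)
    [K.FiniteIndex] : HasSlowGenSets K := by
  classical
  -- every coset has a representative of length at most `d`, uniformly in the generating set
  set d := K.index with hd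
  intro k
  obtain ⟨S, hS⟩ := h ((2 * d + 1) * k)
  have hmono : ∀ {a b : ℕ}, a ≤ b → S ^ a ⊆ S ^ b := fun hab =>
    Set.pow_subset_pow_right hS.one_mem hab
  let q : ℕ → Set (G ⧸ K) := fun n => (QuotientGroup.mk : G → G ⧸ K) '' (S ^ n)
  have hqmono : Monotone q := fun a b hab => Set.image_mono (hmono hab)
  have hqstep : ∀ n, q (n + 1) = q n → q (n + 2) = q (n + 1) := by
    intro n hn
    refine subset_antisymm ?_ (hqmono (by omega))
    rintro _ ⟨g, hg, rfl⟩
    rw [show n + 2 = 1 + (n + 1) by ring, pow_add, pow_one] at hg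
    obtain ⟨x, hx, y, hy, rfl⟩ := hg
    obtain ⟨y', hy', hyy⟩ : (QuotientGroup.mk y : G ⧸ K) ∈ q n := hn ▸ ⟨y, hy, rfl⟩
    refine ⟨x * y', ?_, ?_⟩
    · rw [add_comm, pow_add, pow_one]
      exact Set.mul_mem_mul hx hy'
    · rw [QuotientGroup.eq] at hyy ⊢
      simpa [mul_assoc] using hyy
  have hcard : ∀ n, q (n + 1) = q n ∨ n + 1 < (q (n + 1)).ncard := by
    intro n
    induction n with
    | zero =>
      by_cases he : q 1 = q 0
      · exact Or.inl he
      · right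
        have := Set.ncard_lt_ncard ((hqmono (Nat.le_succ 0)).ssubset_of_ne (Ne.symm he))
          (Set.toFinite _)
        have h0 : (q 0).ncard = 1 := by simp [q]
        simp only [Nat.succ_eq_add_one, Nat.zero_add] at this ⊢
        omega
    | succ n ih =>
      by_cases he : q (n + 2) = q (n + 1)
      · exact Or.inl he
      · right
        have h1 := Set.ncard_lt_ncard
          ((hqmono (Nat.le_succ (n + 1))).ssubset_of_ne (Ne.symm he)) (Set.toFinite _)
        have h2 := ih.resolve_left (fun h' => he (hqstep n h'))
        simp only [Nat.succ_eq_add_one] at h1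
        omega
  have hstab : q (d + 1) = q d := by
    refine (hcard d).resolve_right fun hlt => ?_
    have h1 : (q (d + 1)).ncard ≤ Nat.card (G ⧸ K) := Set.ncard_le_card _
    have h2 : Nat.card (G ⧸ K) = d := rfl
    omega
  let T : Set K := {t | (t : G) ∈ S ^ (2 * d + 1)}
  have hT1 : (1 : K) ∈ T := Set.one_mem_pow hS.one_mem
  have key : ∀ n, ∀ g ∈ S ^ n, ∃ r ∈ S ^ d, ∃ t ∈ Subgroup.closure T, g = r * t := by
    intro n
    induction n with
    | zero =>
      intro g hg
      exact ⟨1, Set.one_mem_pow hS.one_mem, 1, one_mem _, by simpa using hg⟩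
    | succ n ih =>
      intro g hg
      rw [add_comm, pow_add, pow_one] at hg
      obtain ⟨x, hx, y, hy, rfl⟩ := hg
      obtain ⟨r, hr, t, ht, rfl⟩ := ih y hy
      have hxr : x * r ∈ S ^ (d + 1) := by
        rw [add_comm, pow_add, pow_one]; exact Set.mul_mem_mul hx hr
      obtain ⟨r', hr', hrr⟩ : (QuotientGroup.mk (x * r) : G ⧸ K) ∈ q d := hstab ▸ ⟨_, hxr, rfl⟩
      rw [QuotientGroup.eq] at hrr
      refine ⟨r', hr', ⟨_, hrr⟩ * t, mul_mem (Subgroup.subset_closure ?_) ht, by simp [mul_assoc]⟩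
      change r'⁻¹ * (x * r) ∈ S ^ (2 * d + 1)
      rw [show 2 * d + 1 = d + (d + 1) by ring, pow_add]
      exact Set.mul_mem_mul (Set.inv_mem_pow hS.inv_mem _ hr') hxr
  refine ⟨T, ?_, hT1, fun x hx => Set.inv_mem_pow hS.inv_mem _ hx, ?_, ?_⟩
  · exact (hS.finite.pow_of_group _).preimage Subtype.val_injective.injOn
  · rw [eq_top_iff]
    intro g _
    obtain ⟨n, hn⟩ := Set.exists_mem_pow_of_closure_eq_top hS.inv_mem hS.closure_eq
      (g : G)
    obtain ⟨r, hr, t, ht, hg⟩ := key n g hn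
    have : g * t⁻¹ ∈ T := by
      change ((g * t⁻¹ : K) : G) ∈ S ^ (2 * d + 1)
      rw [Subgroup.coe_mul, Subgroup.coe_inv, hg, mul_inv_cancel_right]
      exact hmono (by omega) hr
    have := mul_mem (Subgroup.subset_closure this) ht
    simpa using this
  · obtain ⟨n, hn⟩ := hS.slow
    refine ⟨n, lt_of_le_of_lt ?_ hn⟩
    rw [← Set.ncard_image_of_injective _ K.subtype_injective, Set.image_pow]
    refine Set.ncard_le_ncard ?_ (hS.finite.pow_of_group _)
    rw [mul_assoc, pow_mul S]
    refine Set.pow_subset_pow_left ?_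
    rintro _ ⟨t, ht, rfl⟩
    exact ht

/-- The subgroup generated by the conjugates `x ^ i * c * x ^ (-i)` for `m ≤ i < n`. -/
def conjClosure {G : Type*} [Group G] (x c : G) (m n : ℤ) : Subgroup G :=
  Subgroup.closure ((fun i : ℤ => x ^ i * c * x ^ (-i)) '' Set.Ico m n)

theorem conj_mem_conjClosure {G : Type*} [Group G] (x c : G) {m n i : ℤ} (h1 : m ≤ i)
    (h2 : i < n) : x ^ i * c * x ^ (-i) ∈ conjClosure x c m n :=
  Subgroup.subset_closure ⟨i, ⟨h1, h2⟩, rfl⟩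

theorem conjClosure_le {G : Type*} [Group G] {x c : G} {m n : ℤ} {F : Subgroup G}
    (h : ∀ i, m ≤ i → i < n → x ^ i * c * x ^ (-i) ∈ F) : conjClosure x c m n ≤ F := by
  refine (Subgroup.closure_le _).2 ?_
  rintro _ ⟨i, ⟨h1, h2⟩, rfl⟩
  exact h i h1 h2

theorem conjClosure_mono {G : Type*} [Group G] (x c : G) {m n m' n' : ℤ} (hm : m' ≤ m)
    (hn : n ≤ n') : conjClosure x c m n ≤ conjClosure x c m' n' :=
  conjClosure_le fun _ h1 h2 => conj_mem_conjClosure x c (hm.trans h1) (h2.trans_le hn)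

theorem conj_mem_conjClosure_add {G : Type*} [Group G] {x c g : G} {m n : ℤ} (j : ℤ)
    (hg : g ∈ conjClosure x c m n) :
    x ^ j * g * x ^ (-j) ∈ conjClosure x c (m + j) (n + j) := by
  have : conjClosure x c m n ≤
      (conjClosure x c (m + j) (n + j)).comap (MulAut.conj (x ^ j)).toMonoidHom := by
    refine conjClosure_le fun i h1 h2 => ?_
    have := conj_mem_conjClosure x c (m := m + j) (n := n + j) (i := i + j) (by omega) (by omega)
    change x ^ j * (x ^ i * c * x ^ (-i)) * (x ^ j)⁻¹ ∈ conjClosure x c (m + j) (n + j)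
    rwa [show x ^ j * (x ^ i * c * x ^ (-i)) * (x ^ j)⁻¹ = x ^ (i + j) * c * x ^ (-(i + j)) by
      group]
  rw [zpow_neg]
  exact this hg

theorem conjClosure_inv {G : Type*} [Group G] (x c : G) (m n : ℤ) :
    conjClosure x⁻¹ c m n ≤ conjClosure x c (1 - n) (1 - m) :=
  conjClosure_le fun i h1 h2 => by
    simpa using conj_mem_conjClosure x c (m := 1 - n) (n := 1 - m) (i := -i) (by omega) (by omega)

/-- Positive words in `c * x` and `x`. -/
def boolWord {G : Type*} [Group G] (x c : G) (l : List Bool) : G :=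
  (l.map fun e => cond e (c * x) x).prod

theorem boolWord_mem {G : Type*} [Group G] (x c : G) (l : List Bool) :
    boolWord x c l * x ^ (-(l.length : ℤ)) ∈ conjClosure x c 0 l.length := by
  induction l with
  | nil => simp [boolWord, one_mem]
  | cons e l ih =>
    have h := conjClosure_mono x c (m' := 0) (n' := (l.length : ℤ) + 1) (by omega) le_rfl
      (conj_mem_conjClosure_add 1 ih)
    have hc : cond e c 1 ∈ conjClosure x c 0 ((l.length : ℤ) + 1) := by
      cases e
      · exact one_mem _
      · simpa using conj_mem_conjClosure x c (m := 0) (n := (l.length : ℤ) + 1) (i := 0) le_rfl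
          (by omega)
    have := mul_mem hc h
    have he : cond e (c * x) x = cond e c 1 * x := by cases e <;> simp
    have hw : boolWord x c (e :: l) = cond e c 1 * x * boolWord x c l := by
      simp [boolWord, he]
    rw [List.length_cons, hw, Nat.cast_succ, show cond e c 1 * x * boolWord x c l *
      x ^ (-((l.length : ℤ) + 1)) = cond e c 1 * (x ^ (1 : ℤ) * (boolWord x c l *
      x ^ (-(l.length : ℤ))) * x ^ (-1 : ℤ)) by group]
    exact this

theorem mem_conjClosure_of_boolWord_eq {G : Type*} [Group G] (x c : G) :
    ∀ l l' : List Bool, l.length = l'.length → l ≠ l' → boolWord x c l = boolWord x c l' →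
      ∃ n : ℕ, c ∈ conjClosure x c 1 n
  | [], [], _, hne, _ => absurd rfl hne
  | [], _ :: _, h, _, _ => by simp at h
  | _ :: _, [], h, _, _ => by simp at h
  | e :: l, e' :: l', hlen, hne, heq => by
    have hlen' : l.length = l'.length := by simpa using hlen
    by_cases hee : e = e'
    · subst hee
      refine mem_conjClosure_of_boolWord_eq x c l l' hlen' (fun h => hne (h ▸ rfl)) ?_
      simpa [boolWord] using heq
    · have h1 := conj_mem_conjClosure_add 1 (boolWord_mem x c l)
      have h2 := conj_mem_conjClosure_add 1 (boolWord_mem x c l')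
      rw [← hlen'] at h2
      refine ⟨l.length + 1, ?_⟩
      rw [zero_add] at h1 h2
      have key : ∀ u v : G, c * x * u = x * v →
          c = (x ^ (1 : ℤ) * (v * x ^ (-(l.length : ℤ))) * x ^ (-1 : ℤ)) *
            (x ^ (1 : ℤ) * (u * x ^ (-(l.length : ℤ))) * x ^ (-1 : ℤ))⁻¹ := by
        intro u v huv
        have : c = x * v * u⁻¹ * x⁻¹ := by rw [← huv]; group
        rw [this]; group
      push_cast
      cases e <;> cases e'
      · exact absurd rfl hee
      · have := mul_mem h1 (inv_mem h2)
        rwa [← key (boolWord x c l') (boolWord x c l) (by simpa [boolWord] using heq.symm)] at this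
      · have := mul_mem h2 (inv_mem h1)
        rwa [← key (boolWord x c l) (boolWord x c l') (by simpa [boolWord] using heq)] at this
      · exact absurd rfl hee

/-- Milnor's lemma for short elements: the conjugates of `c` by the powers of `x` generate a
finitely generated subgroup. -/
theorem IsSlowGenSet.exists_fg_conj {G : Type*} [Group G] {k a b : ℕ} {S : Set G}
    (h : IsSlowGenSet k S) (hab : a + b ≤ k) {x c : G} (hx : x ∈ S ^ a) (hc : c ∈ S ^ b)
    {H : Subgroup G} (hH : ∀ i : ℤ, x ^ i * c * x ^ (-i) ∈ H) :
    ∃ F : Subgroup G, F.FG ∧ F ≤ H ∧ ∀ i : ℤ, x ^ i * c * x ^ (-i) ∈ F := by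
  have hmono : ∀ {a b : ℕ}, a ≤ b → S ^ a ⊆ S ^ b := fun hab =>
    Set.pow_subset_pow_right h.one_mem hab
  have hrel : ∀ y ∈ S ^ a, ∃ n : ℕ, c ∈ conjClosure y c 1 n := by
    intro y hy
    obtain ⟨l, l', hlen, hne, heq⟩ := h.exists_collision (a := c * y) (b := y)
      (hmono hab (by rw [add_comm, pow_add]; exact Set.mul_mem_mul hc hy)) (hmono (by omega) hy)
    exact mem_conjClosure_of_boolWord_eq y c l l' hlen hne heq
  obtain ⟨m, hm⟩ := hrel x hx
  obtain ⟨n, hn⟩ := hrel x⁻¹ (Set.inv_mem_pow h.inv_mem x hx)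
  replace hn := conjClosure_inv _ _ _ _ hn
  set N : ℤ := m + n + 1 with hN
  have hup : ∀ g ∈ conjClosure x c 0 N, x * g * x⁻¹ ∈ conjClosure x c 0 N := by
    intro g hg
    have h1 := conj_mem_conjClosure_add 1 hg
    rw [zpow_neg, zpow_one] at h1
    refine (conjClosure_le fun i hi1 hi2 => ?_ : conjClosure x c (0 + 1) (N + 1) ≤ _) h1
    rcases lt_or_ge i N with hlt | hge
    · exact conj_mem_conjClosure x c (by omega) hlt
    · obtain rfl : i = N := by omega
      exact conjClosure_mono x c (by omega) (by omega) (conj_mem_conjClosure_add N hn)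
  have hdown : ∀ g ∈ conjClosure x c 0 N, x⁻¹ * g * x ∈ conjClosure x c 0 N := by
    intro g hg
    have h1 := conj_mem_conjClosure_add (-1) hg
    rw [neg_neg, zpow_neg, zpow_one] at h1
    refine (conjClosure_le fun i hi1 hi2 => ?_ : conjClosure x c (0 + -1) (N + -1) ≤ _) h1
    rcases lt_or_ge i 0 with hlt | hge
    · obtain rfl : i = -1 := by omega
      exact conjClosure_mono x c (by omega) (by omega) (conj_mem_conjClosure_add (-1) hm)
    · exact conj_mem_conjClosure x c hge (by omega)
  refine ⟨conjClosure x c 0 N, ?_, conjClosure_le fun i _ _ => hH i, fun i => ?_⟩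
  · exact (Subgroup.fg_iff _).2 ⟨_, rfl, (Set.finite_Ico 0 N).image _⟩
  · induction i using Int.induction_on with
    | zero => exact conj_mem_conjClosure x c le_rfl (by omega)
    | succ i ih =>
      have := hup _ ih
      rwa [show x * (x ^ (i : ℤ) * c * x ^ (-(i : ℤ))) * x⁻¹ =
        x ^ ((i : ℤ) + 1) * c * x ^ (-((i : ℤ) + 1)) by group] at this
    | pred i ih =>
      have := hdown _ ih
      rwa [show x⁻¹ * (x ^ (-(i : ℤ)) * c * x ^ (- -(i : ℤ))) * x =
        x ^ (-(i : ℤ) - 1) * c * x ^ (-(-(i : ℤ) - 1)) by group] at this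

namespace Subgroup

variable {G : Type*} [Group G]

/-- The elements which are central modulo a normal subgroup `P`. -/
def centralMod (P : Subgroup G) [P.Normal] : Subgroup G :=
  (center (G ⧸ P)).comap (QuotientGroup.mk' P)

instance (P : Subgroup G) [P.Normal] : P.centralMod.Normal :=
  Normal.comap inferInstance _

theorem commutatorElement_mem_iff (P : Subgroup G) [P.Normal] {z g : G} :
    ⁅z, g⁆ ∈ P ↔ Commute (z : G ⧸ P) (g : G ⧸ P) := by
  rw [← commutatorElement_eq_one_iff_commute, ← QuotientGroup.eq_one_iff]
  rfl

theorem mem_centralMod {P : Subgroup G} [P.Normal] {z : G} :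
    z ∈ P.centralMod ↔ ∀ g, ⁅z, g⁆ ∈ P := by
  simp only [commutatorElement_mem_iff, centralMod, mem_comap, mem_center_iff]
  constructor
  · intro h g
    exact (h g).symm
  · intro h g
    obtain ⟨g, rfl⟩ := QuotientGroup.mk_surjective g
    exact (h g).symm

theorem commutator_top_le_iff {P Q : Subgroup G} [P.Normal] :
    ⁅Q, ⊤⁆ ≤ P ↔ Q ≤ P.centralMod := by
  rw [commutator_le]
  exact ⟨fun h z hz => mem_centralMod.2 fun g => h z hz g (mem_top g),
    fun h z hz g _ => mem_centralMod.1 (h hz) g⟩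

theorem mem_centralMod_of_closure {P : Subgroup G} [P.Normal] {T : Set G} (hT : closure T = ⊤)
    {z : G} (h : ∀ y ∈ T, ⁅z, y⁆ ∈ P) : z ∈ P.centralMod := by
  have : closure T ≤ (centralizer {(z : G ⧸ P)}).comap (QuotientGroup.mk' P) := by
    rw [closure_le]
    intro y hy
    exact mem_centralizer_singleton_iff.2 (P.commutatorElement_mem_iff.1 (h y hy)).symm
  rw [hT] at this
  exact mem_centralMod.2 fun g => P.commutatorElement_mem_iff.2
    (mem_centralizer_singleton_iff.1 (this (mem_top g))).symm

/-- The set of left-normed commutators of weight `i + 1` with entries in `T`. -/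
def leftNormedCommutators {G : Type*} [Group G] (T : Set G) : ℕ → Set G
  | 0 => T
  | i + 1 => Set.image2 (fun z y => ⁅z, y⁆) (leftNormedCommutators T i) T

variable {T : Set G}

theorem finite_leftNormedCommutators (hT : T.Finite) (i : ℕ) :
    (leftNormedCommutators T i).Finite := by
  induction i with
  | zero => exact hT
  | succ i ih => exact ih.image2 _ hT

theorem leftNormedCommutators_subset_pow (h1 : (1 : G) ∈ T) (hinv : ∀ x ∈ T, x⁻¹ ∈ T) (i : ℕ) :
    leftNormedCommutators T i ⊆ T ^ 4 ^ i := by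
  induction i with
  | zero => simp [leftNormedCommutators]
  | succ i ih =>
    rintro _ ⟨z, hz, y, hy, rfl⟩
    have h4 : 1 ≤ 4 ^ i := Nat.one_le_pow _ _ (by norm_num)
    refine Set.pow_subset_pow_right h1
      (show 4 ^ i + 1 + 4 ^ i + 1 ≤ 4 ^ (i + 1) by rw [pow_succ]; omega) ?_
    rw [pow_succ, pow_add, pow_succ]
    exact Set.mul_mem_mul (Set.mul_mem_mul (Set.mul_mem_mul (ih hz) hy)
      (Set.inv_mem_pow hinv _ (ih hz))) (hinv _ hy)

theorem leftNormedCommutators_subset_lowerCentralSeries (i : ℕ) :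
    leftNormedCommutators T i ⊆ (⊤ : Subgroup G).lowerCentralSeries i := by
  induction i with
  | zero => exact fun _ _ => mem_top _
  | succ i ih =>
    rintro _ ⟨z, hz, y, hy, rfl⟩
    exact commutator_mem_commutator (ih hz) (mem_top y)

theorem lowerCentralSeries_le_of_leftNormedCommutators {P : Subgroup G} [P.Normal]
    (hT : closure T = ⊤) {i : ℕ} (h : leftNormedCommutators T (i + 1) ⊆ P) {z : G}
    (hz : z ∈ leftNormedCommutators T i) : z ∈ P.centralMod :=
  mem_centralMod_of_closure hT fun y hy => h ⟨z, hz, y, hy, rfl⟩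

theorem lowerCentralSeries_eq_closure_sup (hT : closure T = ⊤) (i : ℕ) :
    (⊤ : Subgroup G).lowerCentralSeries i =
      closure (leftNormedCommutators T i) ⊔ (⊤ : Subgroup G).lowerCentralSeries (i + 1) := by
  induction i with
  | zero => simp [leftNormedCommutators, hT]
  | succ i ih =>
    have hle : closure (leftNormedCommutators T (i + 1)) ⊔
        (⊤ : Subgroup G).lowerCentralSeries (i + 2) ≤
        (⊤ : Subgroup G).lowerCentralSeries (i + 1) :=
      sup_le ((closure_le _).2 (leftNormedCommutators_subset_lowerCentralSeries _))
        (lowerCentralSeries_antitone _ (Nat.le_succ _))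
    set P := closure (leftNormedCommutators T (i + 1)) ⊔
      (⊤ : Subgroup G).lowerCentralSeries (i + 2) with hP
    have : P.Normal :=
      commutator_top_right_le_iff.1 ((commutator_mono hle le_rfl).trans le_sup_right)
    refine le_antisymm ?_ hle
    rw [lowerCentralSeries_succ, commutator_top_le_iff, ih, sup_le_iff, closure_le]
    refine ⟨fun z hz => lowerCentralSeries_le_of_leftNormedCommutators hT
      (subset_closure.trans (SetLike.coe_subset_coe.2 le_sup_left)) hz, ?_⟩
    rw [← commutator_top_le_iff]
    exact le_sup_right

theorem lowerCentralSeries_eq_normalClosure (hT : closure T = ⊤) (i : ℕ) :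
    (⊤ : Subgroup G).lowerCentralSeries i = normalClosure (leftNormedCommutators T i) := by
  refine le_antisymm ?_
    (normalClosure_le_normal (leftNormedCommutators_subset_lowerCentralSeries i))
  induction i with
  | zero =>
    rw [lowerCentralSeries_zero, ← hT]
    exact closure_le_normalClosure
  | succ i ih =>
    rw [lowerCentralSeries_succ, commutator_top_le_iff]
    exact ih.trans (normalClosure_le_normal fun z hz =>
      lowerCentralSeries_le_of_leftNormedCommutators hT subset_normalClosure hz)

theorem FG.map_hom {G' : Type*} [Group G'] {F : Subgroup G} (hF : F.FG) (f : G →* G') :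
    (F.map f).FG := by
  obtain ⟨S, rfl, hS⟩ := (Subgroup.fg_iff _).1 hF
  exact (Subgroup.fg_iff _).2 ⟨f '' S, (f.map_closure S).symm, hS.image f⟩

theorem fg_inf_zpowers (H : Subgroup G) (z : G) : (H ⊓ zpowers z).FG := by
  have h : ((H.comap (zpowersHom G z)).map (zpowersHom G z)).FG := by
    refine FG.map_hom ?_ _
    obtain ⟨g, hg⟩ := isCyclic_iff_exists_zpowers_eq_top.1
      (inferInstance : IsCyclic (H.comap (zpowersHom G z)))
    rw [← Group.fg_iff_subgroup_fg]
    exact Group.fg_iff.2 ⟨{g}, by rw [← zpowers_eq_closure, hg], Set.finite_singleton g⟩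
  rwa [map_comap_eq, inf_comm] at h

/-- If a normal subgroup `H` becomes finitely generated after adding an element `z` which is
central modulo `H`, and the conjugates of each `⁅z, y⁆` under powers of `z` lie in a finitely
generated subgroup of `H`, then `H` is finitely generated. -/
theorem fg_of_fg_sup_zpowers {H : Subgroup G} [H.Normal] (hT : closure T = ⊤) {z : G}
    (h : ∀ y ∈ T, ∃ F : Subgroup G, F.FG ∧ F ≤ H ∧ ∀ i : ℤ, z ^ i * ⁅z, y⁆ * z ^ (-i) ∈ F)
    (hfg : (H ⊔ zpowers z).FG) : H.FG := by
  have key : ∀ g, ∃ F : Subgroup G, F.FG ∧ F ≤ H ∧ ∀ i : ℤ, ⁅z ^ i, g⁆ ∈ F := by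
    intro g
    have hg : g ∈ closure T := hT ▸ mem_top g
    induction hg using closure_induction with
    | one => exact ⟨⊥, FG.bot, bot_le, fun i => by simp⟩
    | mem y hy =>
      obtain ⟨F, hF, hFH, hi⟩ := h y hy
      refine ⟨F, hF, hFH, fun i => ?_⟩
      induction i using Int.induction_on with
      | zero => simp [one_mem]
      | succ i ih =>
        have := mul_mem (hi i) ih
        rwa [show z ^ (i : ℤ) * ⁅z, y⁆ * z ^ (-(i : ℤ)) * ⁅z ^ (i : ℤ), y⁆ =
          ⁅z ^ ((i : ℤ) + 1), y⁆ by simp only [commutatorElement_def]; group] at this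
      | pred i ih =>
        have := mul_mem (inv_mem (hi (-(i : ℤ) - 1))) ih
        rwa [show (z ^ (-(i : ℤ) - 1) * ⁅z, y⁆ * z ^ (-(-(i : ℤ) - 1)))⁻¹ * ⁅z ^ (-(i : ℤ)), y⁆ =
          ⁅z ^ (-(i : ℤ) - 1), y⁆ by simp only [commutatorElement_def]; group] at this
    | mul a b _ _ ha hb =>
      obtain ⟨F, hF, hFH, hi⟩ := ha
      obtain ⟨F', hF', hFH', hi'⟩ := hb
      refine ⟨F ⊔ F'.map (MulAut.conj a).toMonoidHom, hF.sup (hF'.map_hom _), sup_le hFH ?_,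
        fun i => ?_⟩
      · rintro _ ⟨f, hf, rfl⟩
        exact Normal.conj_mem inferInstance f (hFH' hf) a
      · rw [commutatorElement_mul_right_eq_mul_conj, mul_assoc, mul_assoc, ← mul_assoc a]
        exact mul_mem (mem_sup_left (hi i)) (mem_sup_right ⟨_, hi' i, rfl⟩)
    | inv a _ ha =>
      obtain ⟨F, hF, hFH, hi⟩ := ha
      refine ⟨F.map (MulAut.conj a⁻¹).toMonoidHom, hF.map_hom _, ?_, fun i => ?_⟩
      · rintro _ ⟨f, hf, rfl⟩
        exact Normal.conj_mem inferInstance f (hFH hf) a⁻¹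
      · refine ⟨_, inv_mem (hi i), ?_⟩
        simp [commutatorElement_def, mul_assoc]
  obtain ⟨R, hR, hRfin⟩ := (Subgroup.fg_iff _).1 hfg
  have hdec : ∀ r ∈ R, ∃ h ∈ H, ∃ k : ℤ, r = h * z ^ k := by
    intro r hr
    have : r ∈ ((H ⊔ zpowers z : Subgroup G) : Set G) := hR ▸ subset_closure hr
    rw [normal_mul] at this
    obtain ⟨h, hh, _, ⟨k, rfl⟩, rfl⟩ := this
    exact ⟨h, hh, k, rfl⟩
  choose! u hu k hk using hdec
  choose F hF hFH hi using key
  set F₁ : Subgroup G := ⨆ r ∈ R, F (u r) ⊔ closure {u r} with hF₁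
  have hF₁fg : F₁.FG :=
    FG.biSup hRfin _ fun r _ => (hF _).sup ((Subgroup.fg_iff _).2 ⟨_, rfl, Set.finite_singleton _⟩)
  have hF₁H : F₁ ≤ H :=
    iSup₂_le fun r hr => sup_le (hFH _) ((closure_le _).2 (by simpa using hu r hr))
  set C : Set G := {g | ∃ r ∈ R, ∃ i : ℤ, z ^ i * u r * z ^ (-i) = g} with hC
  have hCF : closure C ≤ F₁ := by
    rw [closure_le]
    rintro _ ⟨r, hr, i, rfl⟩
    have hle : F (u r) ⊔ closure {u r} ≤ F₁ :=
      le_iSup₂ (f := fun r (_ : r ∈ R) => F (u r) ⊔ closure {u r}) r hr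
    have := mul_mem (hle (mem_sup_left (hi (u r) i)))
      (hle (mem_sup_right (subset_closure (Set.mem_singleton _))))
    rwa [show ⁅z ^ i, u r⁆ * u r = z ^ i * u r * z ^ (-i) by
      simp only [commutatorElement_def]; group] at this
  have hnorm : zpowers z ≤ normalizer (closure C : Set G) := by
    rw [le_normalizer_closure_iff]
    rintro _ ⟨j, rfl⟩ _ ⟨r, hr, i, rfl⟩
    refine subset_closure ⟨r, hr, j + i, ?_⟩
    simp only
    group
  have hle : H ⊔ zpowers z ≤ closure C ⊔ zpowers z := by
    rw [← hR, closure_le]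
    intro r hr
    rw [hk r hr]
    exact mul_mem (mem_sup_left (subset_closure ⟨r, hr, 0, by simp⟩))
      (mem_sup_right ⟨k r, rfl⟩)
  have : H = F₁ ⊔ H ⊓ zpowers z := by
    refine le_antisymm (fun x hx => ?_) (sup_le hF₁H inf_le_left)
    have hx' : x ∈ ((closure C ⊔ zpowers z : Subgroup G) : Set G) := hle (mem_sup_left hx)
    rw [coe_mul_of_right_le_normalizer_left _ _ hnorm] at hx'
    obtain ⟨f, hf, w, hw, rfl⟩ := hx'
    refine mul_mem (mem_sup_left (hCF hf)) (mem_sup_right ⟨?_, hw⟩)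
    simpa using mul_mem (inv_mem (hF₁H (hCF hf))) hx
  rw [this]
  exact hF₁fg.sup (fg_inf_zpowers H z)

theorem fg_of_fg_sup_closure (hT : closure T = ⊤) {Z : Set G} (hZ : Z.Finite) :
    ∀ {H : Subgroup G} [H.Normal], (∀ z ∈ Z, ∀ y ∈ T, ∃ F : Subgroup G, F.FG ∧ F ≤ H ∧
      ∀ i : ℤ, z ^ i * ⁅z, y⁆ * z ^ (-i) ∈ F) → (H ⊔ closure Z).FG → H.FG := by
  induction Z, hZ using Set.Finite.induction_on with
  | empty =>
    intro H _ _ h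
    simpa using h
  | @insert z Z _ _ ih =>
    intro H hH hZ hfg
    refine fg_of_fg_sup_zpowers hT (hZ z (Set.mem_insert _ _)) ?_
    have hz : z ∈ H.centralMod := by
      refine mem_centralMod_of_closure hT fun y hy => ?_
      obtain ⟨F, -, hF, hi⟩ := hZ z (Set.mem_insert _ _) y hy
      simpa using hF (hi 0)
    have : (H ⊔ zpowers z).Normal := by
      refine commutator_top_right_le_iff.1 ?_
      refine le_trans (commutator_top_le_iff.2 ?_) le_sup_left
      refine sup_le ?_ (zpowers_le.2 hz)
      rw [← commutator_top_le_iff]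
      exact commutator_le_left H ⊤
    refine ih (fun w hw y hy => ?_) ?_
    · obtain ⟨F, hF, hFH, hi⟩ := hZ w (Set.mem_insert_of_mem _ hw) y hy
      exact ⟨F, hF, hFH.trans le_sup_left, hi⟩
    · rwa [sup_assoc, zpowers_eq_closure, ← closure_union, Set.singleton_union]

/-- In a group with slow generating sets, kernels of maps onto nilpotent groups are finitely
generated. -/
theorem _root_.HasSlowGenSets.fg_of_lowerCentralSeries_le (hG : HasSlowGenSets G) {H : Subgroup G}
    [H.Normal] {t : ℕ} (h : (⊤ : Subgroup G).lowerCentralSeries t ≤ H) : H.FG := by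
  suffices key : ∀ i, (H ⊔ (⊤ : Subgroup G).lowerCentralSeries i).FG by
    simpa [h] using key t
  intro i
  induction i with
  | zero =>
    rw [lowerCentralSeries_zero, sup_top_eq]
    exact hG.fg.out
  | succ i ih =>
    obtain ⟨S, hS⟩ := hG (4 ^ i + 4 ^ (i + 1))
    rw [lowerCentralSeries_eq_closure_sup hS.closure_eq i, sup_comm (closure _),
      ← sup_assoc] at ih
    refine fg_of_fg_sup_closure hS.closure_eq (finite_leftNormedCommutators hS.finite i) ?_ ih
    intro z hz y hy
    have hzy : ⁅z, y⁆ ∈ leftNormedCommutators S (i + 1) := ⟨z, hz, y, hy, rfl⟩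
    refine hS.exists_fg_conj le_rfl
      (leftNormedCommutators_subset_pow hS.one_mem hS.inv_mem i hz)
      (leftNormedCommutators_subset_pow hS.one_mem hS.inv_mem (i + 1) hzy) fun j => ?_
    rw [zpow_neg]
    exact Normal.conj_mem inferInstance _
      (mem_sup_right (leftNormedCommutators_subset_lowerCentralSeries _ hzy)) _

end Subgroup

namespace Subgroup

variable {G : Type*} [Group G]

theorem finiteIndex_of_sup_zpowers {P : Subgroup G} {z : G} (hz : z ∈ normalizer (P : Set G))
    {e : ℕ} (he : 0 < e) (hze : z ^ e ∈ P) (h : (P ⊔ zpowers z).FiniteIndex) :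
    P.FiniteIndex := by
  have : NeZero e := ⟨he.ne'⟩
  let f : (G ⧸ (P ⊔ zpowers z)) × ZMod e → G ⧸ P := fun p => (p.1.out * z ^ p.2.val : G)
  have hf : Function.Surjective f := by
    intro q
    obtain ⟨g, rfl⟩ := QuotientGroup.mk_surjective q
    obtain ⟨x, hx⟩ := QuotientGroup.mk_out_eq_mul (P ⊔ zpowers z) g
    have hx2 : ((x : G)⁻¹) ∈ ((zpowers z ⊔ P : Subgroup G) : Set G) :=
      sup_comm P (zpowers z) ▸ inv_mem x.2
    rw [coe_mul_of_left_le_normalizer_right _ _ (zpowers_le.2 hz)] at hx2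
    obtain ⟨_, ⟨k, rfl⟩, p, hp, hkp⟩ := hx2
    refine ⟨(((g : G) : G ⧸ (P ⊔ zpowers z)), (k : ZMod e)), ?_⟩
    change ((_ : G) : G ⧸ P) = _
    rw [QuotientGroup.eq]
    have hg : g = (g : G ⧸ (P ⊔ zpowers z)).out * (z ^ k * p) := by
      have hkp' : z ^ k * p = (x : G)⁻¹ := hkp
      rw [hkp', hx, mul_inv_cancel_right]
    have h1 : z ^ k = z ^ (k : ZMod e).val * (z ^ e) ^ (k / e) := by
      rw [← zpow_natCast, ← zpow_natCast, ← zpow_mul, ← zpow_add, ZMod.val_intCast,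
        Int.emod_add_mul_ediv]
    have h2 : ((g : G ⧸ (P ⊔ zpowers z)).out * z ^ (k : ZMod e).val)⁻¹ * g =
        (z ^ e) ^ (k / e) * p := by
      rw [inv_mul_eq_iff_eq_mul, mul_assoc, ← mul_assoc (z ^ _), ← h1, ← hg]
    exact h2 ▸ mul_mem (zpow_mem hze (k / e)) hp
  have := Finite.of_surjective f hf
  exact finiteIndex_of_finite_quotient

theorem finiteIndex_of_sup_closure {N R : Subgroup G} (hNR : ⁅N, ⊤⁆ ≤ R) {Z : Set G}
    (hZ : Z.Finite) : ∀ {P : Subgroup G}, R ≤ P → (∀ z ∈ Z, z ∈ N ∧ ∃ e : ℕ, 0 < e ∧ z ^ e ∈ P) →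
      (P ⊔ closure Z).FiniteIndex → P.FiniteIndex := by
  induction Z, hZ using Set.Finite.induction_on with
  | empty =>
    intro P _ _ h
    simpa using h
  | @insert z Z _ _ ih =>
    intro P hRP hZ hfin
    obtain ⟨hz, e, he, hze⟩ := hZ z (Set.mem_insert _ _)
    have hnorm : N ≤ normalizer (P : Set G) := by
      rw [le_normalizer_iff]
      intro n hn p hp
      have := mul_mem (hRP (hNR (commutator_mem_commutator hn (mem_top p)))) hp
      simpa [commutatorElement_def] using this
    refine finiteIndex_of_sup_zpowers (hnorm hz) he hze (ih (hRP.trans le_sup_left) ?_ ?_)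
    · intro w hw
      obtain ⟨hwN, e, he, hwe⟩ := hZ w (Set.mem_insert_of_mem _ hw)
      exact ⟨hwN, e, he, mem_sup_left hwe⟩
    · rwa [sup_assoc, zpowers_eq_closure, ← closure_union, Set.singleton_union]

theorem pow_mul_of_mul_eq {a y c : G} (hc : ∀ g, Commute c g) (h : a * y = c * (y * a)) (m : ℕ) :
    a ^ m * y = c ^ m * (y * a ^ m) := by
  induction m with
  | zero => simp
  | succ m ih =>
    rw [pow_succ, mul_assoc, h, ← mul_assoc, ((hc (a ^ m)).eq).symm, mul_assoc, ← mul_assoc (a ^ m),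
      ih, pow_succ' c]
    simp only [mul_assoc]

theorem commutatorElement_pow_pow {a y : G} (hc : ∀ g, Commute ⁅a, y⁆ g) (m n : ℕ) :
    ⁅a ^ m, y ^ n⁆ = ⁅a, y⁆ ^ (m * n) := by
  have h1 := pow_mul_of_mul_eq hc (a := a) (y := y) (by simp [commutatorElement_def, mul_assoc]) m
  have h2 : y * a ^ m = (⁅a, y⁆ ^ m)⁻¹ * (a ^ m * y) := by rw [h1, inv_mul_cancel_left]
  have h3 := pow_mul_of_mul_eq (fun g => ((hc g).pow_left m).inv_left) h2 n
  rw [commutatorElement_def, mul_inv_eq_iff_eq_mul, mul_inv_eq_iff_eq_mul, mul_assoc, h3, pow_mul,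
    inv_pow, mul_inv_cancel_left]

theorem finiteIndex_sup_lowerCentralSeries {T : Set G} (hTfin : T.Finite) (hT : closure T = ⊤)
    {L : Subgroup G} {D : ℕ} (hD : 0 < D) (h : ∀ x ∈ T, x ^ D ∈ L) (i : ℕ) :
    (L ⊔ (⊤ : Subgroup G).lowerCentralSeries i).FiniteIndex := by
  induction i with
  | zero =>
    rw [lowerCentralSeries_zero, sup_top_eq]
    infer_instance
  | succ i ih =>
    refine finiteIndex_of_sup_closure (N := (⊤ : Subgroup G).lowerCentralSeries i) le_rfl
      (finite_leftNormedCommutators hTfin i) le_sup_right (fun z hz => ?_) ?_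
    · refine ⟨leftNormedCommutators_subset_lowerCentralSeries i hz, ?_⟩
      cases i with
      | zero => exact ⟨D, hD, mem_sup_left (h z hz)⟩
      | succ i =>
        obtain ⟨a, ha, y, hy, rfl⟩ := hz
        obtain ⟨m, hm, -, ham⟩ := exists_pow_mem_of_index_ne_zero ih.index_ne_zero a
        refine ⟨m * D, Nat.mul_pos hm hD, ?_⟩
        set R := (⊤ : Subgroup G).lowerCentralSeries (i + 1 + 1) with hR
        have hcent : ∀ g : G ⧸ R, Commute ⁅(a : G ⧸ R), (y : G ⧸ R)⁆ g := by
          intro g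
          obtain ⟨g, rfl⟩ := QuotientGroup.mk_surjective g
          refine (R.commutatorElement_mem_iff (z := ⁅a, y⁆)).1 ?_
          exact commutator_mem_commutator (commutator_mem_commutator
            (leftNormedCommutators_subset_lowerCentralSeries i ha) (mem_top y)) (mem_top g)
        have h1 : ((⁅a ^ m, y ^ D⁆ : G) : G ⧸ R) = (⁅a, y⁆ ^ (m * D) : G) :=
          commutatorElement_pow_pow hcent m D
        have h2 : ⁅a ^ m, y ^ D⁆ ∈ L ⊔ R := by
          have ham' : a ^ m ∈ ((L ⊔ (⊤ : Subgroup G).lowerCentralSeries (i + 1) : Subgroup G) :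
            Set G) := ham
          rw [mul_normal] at ham'
          obtain ⟨l, hl, c, hc, hlc⟩ := ham'
          have hlc' : l * c = a ^ m := hlc
          rw [← hlc', commutatorElement_mul_left_eq_conj_mul]
          have hcR : ⁅c, y ^ D⁆ ∈ R := commutator_mem_commutator hc (mem_top _)
          refine mul_mem (mem_sup_right (Normal.conj_mem inferInstance _ hcR l)) (mem_sup_left ?_)
          exact mul_mem (mul_mem (mul_mem hl (h y hy)) (inv_mem hl)) (inv_mem (h y hy))
        have h3 := mul_mem h2 (mem_sup_right (QuotientGroup.eq.1 h1) : _ ∈ L ⊔ R)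
        rwa [mul_inv_cancel_left] at h3
    · rwa [sup_assoc, sup_comm _ (closure _), ← lowerCentralSeries_eq_closure_sup hT]

theorem finite_monoidHom_of_fg {A B : Type*} [Group A] [Group B] [Group.FG A] [Finite B] :
    Finite (A →* B) := by
  obtain ⟨S, hS⟩ := (Group.FG.out : (⊤ : Subgroup A).FG)
  refine Finite.of_injective (fun f : A →* B => fun s : S => f s) fun f g hfg => ?_
  refine MonoidHom.eq_of_eqOn_dense hS fun s hs => ?_
  exact congrFun hfg ⟨s, hs⟩

/-- A finite index subgroup centralizes a finitely generated normal subgroup modulo a given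
subgroup of finite index. -/
theorem exists_finiteIndex_commutator_le (A : Subgroup G) [A.Normal] [Group.FG A] (M : Subgroup A)
    [M.FiniteIndex] : ∃ K : Subgroup G, K.FiniteIndex ∧ ⁅A, K⁆ ≤ M.map A.subtype := by
  let ρ := MulAction.toPermHom A (A ⧸ M)
  have : Finite (Equiv.Perm (A ⧸ M)) := inferInstance
  have hfin : Finite (A →* Equiv.Perm (A ⧸ M)) := finite_monoidHom_of_fg
  let K : Subgroup G :=
    { carrier := {g | ∀ a, ρ (MulAut.conjNormal g a) = ρ a}
      one_mem' := fun a => by simp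
      mul_mem' := fun {g h} hg hh a => by rw [map_mul, MulAut.mul_apply, hg, hh]
      inv_mem' := fun {g} hg a => by
        rw [← hg, ← MulAut.mul_apply, ← map_mul, mul_inv_cancel, map_one, MulAut.one_apply] }
  refine ⟨K, ?_, ?_⟩
  · let f : G ⧸ K → (A →* Equiv.Perm (A ⧸ M)) := fun q =>
      ρ.comp (MulAut.conjNormal (q.out⁻¹)).toMonoidHom
    have hf : Function.Injective f := by
      intro p q hpq
      rw [← QuotientGroup.out_eq' p, ← QuotientGroup.out_eq' q, QuotientGroup.eq]
      refine inv_mem_iff.1 fun b => ?_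
      have := DFunLike.congr_fun hpq (MulAut.conjNormal p.out b)
      simp only [f, MonoidHom.comp_apply, MulEquiv.coe_toMonoidHom, ← MulAut.mul_apply,
        ← map_mul, inv_mul_cancel, map_one, MulAut.one_apply] at this
      rw [this]
      simp
    have := Finite.of_injective f hf
    exact finiteIndex_of_finite_quotient
  · rw [commutator_le]
    intro a ha k hk
    refine ⟨⟨a, ha⟩ * MulAut.conjNormal k ⟨a, ha⟩⁻¹, ?_, ?_⟩
    · refine normalCore_le M ?_
      rw [normalCore_eq_ker, MonoidHom.mem_ker, map_mul]
      have := hk ⟨a, ha⟩⁻¹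
      rw [this, ← map_mul, mul_inv_cancel, map_one]
    · simp [commutatorElement_def, mul_assoc]

end Subgroup

namespace Polynomial

/-- If the complex roots of a monic integer polynomial of degree `n` are sufficiently close to the
unit disc, then they are roots of unity of bounded order (Kronecker). -/
theorem exists_pow_eq_one_of_norm_pow_lt_two (n : ℕ) : ∃ k D : ℕ, 0 < D ∧
    ∀ f : ℤ[X], f.Monic → f.natDegree = n → f.coeff 0 ≠ 0 →
      (∀ z ∈ (f.map (Int.castRingHom ℂ)).roots, ‖z‖ ^ k < 2) →
        ∀ z ∈ (f.map (Int.castRingHom ℂ)).roots, z ^ D = 1 := by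
  have hroot : ∀ {f : ℤ[X]}, f.coeff 0 ≠ 0 → ∀ z ∈ (f.map (Int.castRingHom ℂ)).roots, z ≠ 0 := by
    rintro f hf z hz rfl
    have := (mem_roots'.1 hz).2
    rw [IsRoot.def, ← coeff_zero_eq_eval_zero, coeff_map] at this
    exact hf (by simpa using this)
  have hmahler : ∀ {f : ℤ[X]}, f.Monic → (f.map (Int.castRingHom ℂ)).mahlerMeasure =
      ((f.map (Int.castRingHom ℂ)).roots.map fun z => max 1 ‖z‖).prod := by
    intro f hf
    rw [mahlerMeasure_eq_leadingCoeff_mul_prod_roots, (hf.map _).leadingCoeff, norm_one, one_mul]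
  have key : ∀ f : ℤ[X], ∃ k D : ℕ, 0 < D ∧ (f.Monic → f.coeff 0 ≠ 0 →
      (∀ z ∈ (f.map (Int.castRingHom ℂ)).roots, ‖z‖ ^ k < 2) →
        ∀ z ∈ (f.map (Int.castRingHom ℂ)).roots, z ^ D = 1) := by
    intro f
    by_cases h : ∀ z ∈ (f.map (Int.castRingHom ℂ)).roots, ‖z‖ ≤ 1
    · by_cases hf : f.Monic ∧ f.coeff 0 ≠ 0
      · have h1 : (f.map (Int.castRingHom ℂ)).mahlerMeasure = 1 := by
          rw [hmahler hf.1]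
          refine Multiset.prod_eq_one fun x hx => ?_
          obtain ⟨z, hz, rfl⟩ := Multiset.mem_map.1 hx
          exact max_eq_left (h z hz)
        have : ∀ z : ℂ, ∃ d : ℕ, 0 < d ∧
            (z ∈ (f.map (Int.castRingHom ℂ)).roots → z ^ d = 1) := by
          intro z
          by_cases hz : z ∈ (f.map (Int.castRingHom ℂ)).roots
          · obtain ⟨d, hd, hzd⟩ := pow_eq_one_of_mahlerMeasure_eq_one h1 (hroot hf.2 z hz)
              (by simpa [aroots] using hz)
            exact ⟨d, hd, fun _ => hzd⟩
          · exact ⟨1, one_pos, fun h => absurd h hz⟩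
        choose d hd hzd using this
        refine ⟨1, ∏ z ∈ (f.map (Int.castRingHom ℂ)).roots.toFinset, d z,
          Finset.prod_pos fun z _ => hd z, fun _ _ _ z hz => ?_⟩
        obtain ⟨c, hc⟩ := Finset.dvd_prod_of_mem d (Multiset.mem_toFinset.2 hz)
        rw [hc, pow_mul, hzd z hz, one_pow]
      · exact ⟨1, 1, one_pos, fun h1 h2 => absurd ⟨h1, h2⟩ hf⟩
    · push Not at h
      obtain ⟨z, hz, hz1⟩ := h
      obtain ⟨k, hk⟩ := pow_unbounded_of_one_lt 2 hz1
      refine ⟨k, 1, one_pos, fun _ _ h => absurd (h z hz) hk.le.not_gt⟩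
  choose k D hD hkD using key
  have hfin := finite_mahlerMeasure_le n (2 ^ n)
  refine ⟨∑ f ∈ hfin.toFinset, k f + 1, ∏ f ∈ hfin.toFinset, D f,
    Finset.prod_pos fun f _ => hD f, fun f hf hn h0 hlt z hz => ?_⟩
  have hpow : ∀ {m : ℕ}, m ≤ ∑ f ∈ hfin.toFinset, k f + 1 →
      ∀ z ∈ (f.map (Int.castRingHom ℂ)).roots, ‖z‖ ^ m < 2 := by
    intro m hm z hz
    rcases le_or_gt ‖z‖ 1 with h1 | h1
    · exact (pow_le_one₀ (norm_nonneg z) h1).trans_lt one_lt_two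
    · exact (pow_le_pow_right₀ h1.le hm).trans_lt (hlt z hz)
  have hmem : f ∈ hfin.toFinset := by
    rw [hfin.mem_toFinset]
    refine ⟨hn.le, ?_⟩
    rw [hmahler hf]
    have hcard : (f.map (Int.castRingHom ℂ)).roots.card ≤ n :=
      (card_roots' _).trans (natDegree_map_le.trans hn.le)
    refine (Multiset.prod_map_le_prod_map₀ _ (fun _ => 2) (fun _ _ => by positivity)
      fun z hz => ?_).trans ?_
    · have := hpow (Nat.le_add_left 1 _) z hz
      rw [pow_one] at this
      exact max_le one_le_two this.le
    · rw [Multiset.map_const', Multiset.prod_replicate]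
      exact_mod_cast pow_le_pow_right₀ (one_le_two (α := ℝ)) hcard
  obtain ⟨c, hc⟩ := Finset.dvd_prod_of_mem D hmem
  rw [hc, pow_mul, hkD f hf h0 (hpow ((Finset.single_le_sum (fun f _ => Nat.zero_le (k f))
    hmem).trans (Nat.le_succ _))) z hz, one_pow]

end Polynomial

namespace Polynomial

/-- The Fox derivative, with respect to `c`, of a positive word in `c * x` and `x`. -/
noncomputable def boolPoly : List Bool → ℤ[X]
  | [] => 0
  | e :: l => cond e 1 0 + X * boolPoly l

theorem one_le_norm_aeval_boolPoly_sub {μ : ℂ} (hμ : 2 ≤ ‖μ‖) :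
    ∀ l l' : List Bool, l.length = l'.length → l ≠ l' →
      1 ≤ ‖aeval μ (boolPoly l - boolPoly l')‖
  | [], [], _, hne => absurd rfl hne
  | [], _ :: _, h, _ => by simp at h
  | _ :: _, [], h, _ => by simp at h
  | e :: l, e' :: l', h, hne => by
    have hsplit : aeval μ (boolPoly (e :: l) - boolPoly (e' :: l')) =
        (cond e 1 0 - cond e' 1 0) + μ * aeval μ (boolPoly l - boolPoly l') := by
      cases e <;> cases e' <;> simp [boolPoly] <;> ring
    rw [hsplit]
    by_cases hl : l = l'
    · subst hl
      cases e <;> cases e' <;> simp at hne ⊢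
    · have ih := one_le_norm_aeval_boolPoly_sub hμ l l' (Nat.succ_injective h) hl
      have h1 : ‖(cond e 1 0 - cond e' 1 0 : ℂ)‖ ≤ 1 := by
        cases e <;> cases e' <;> simp
      have h2 := norm_sub_le
        ((cond e 1 0 - cond e' 1 0 : ℂ) + μ * aeval μ (boolPoly l - boolPoly l'))
        (cond e 1 0 - cond e' 1 0)
      rw [add_sub_cancel_left, norm_mul] at h2
      nlinarith

/-- A monic complex polynomial whose roots are all `D`-th roots of unity divides a power of
`X ^ D - 1`. -/
theorem Monic.dvd_X_pow_sub_one_pow {f : ℂ[X]} (hf : f.Monic) {D : ℕ}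
    (h : ∀ z ∈ f.roots, z ^ D = 1) : f ∣ (X ^ D - 1) ^ f.natDegree := by
  have hs := IsAlgClosed.splits f
  have hprod := hs.eq_prod_roots_of_monic hf
  have hdvd := Multiset.prod_dvd_prod_of_dvd (S := f.roots) (fun z => X - C z)
    (fun _ => X ^ D - 1) fun z hz => by
      rw [dvd_iff_isRoot]
      simp [h z hz]
  rw [← hprod, Multiset.map_const', Multiset.prod_replicate] at hdvd
  exact hdvd.trans (pow_dvd_pow _ (card_roots' f))

end Polynomial

theorem boolWord_eq_mul {G : Type*} [Group G] {A : Subgroup G} [A.Normal] {V : Type*}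
    [AddCommGroup V] (ρ : Representation ℤ G V) (π : Additive A →+ V)
    (hπ : ∀ (g : G) (a : A), π (.ofMul (MulAut.conjNormal g a)) = ρ g (π (.ofMul a)))
    (x : G) (c : A) (l : List Bool) :
    ∃ a : A, boolWord x c l = a * x ^ l.length ∧
      π (.ofMul a) = Polynomial.aeval (ρ x) (Polynomial.boolPoly l) (π (.ofMul c)) := by
  induction l with
  | nil => exact ⟨1, by simp [boolWord], by simp [Polynomial.boolPoly]⟩
  | cons e l ih =>
    obtain ⟨a, ha, hπa⟩ := ih
    refine ⟨cond e c 1 * MulAut.conjNormal x a, ?_, ?_⟩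
    · rw [boolWord] at ha
      rw [boolWord, List.map_cons, List.prod_cons, ha]
      cases e <;> simp [MulAut.conjNormal_apply, pow_succ', mul_assoc]
    · rw [ofMul_mul, map_add, hπ, hπa]
      cases e <;> simp [Polynomial.boolPoly]

/-- In a representation on an abelian quotient of a normal subgroup, short elements are
annihilated by polynomials without large roots. -/
theorem IsSlowGenSet.exists_aeval_eq_zero {G : Type*} [Group G] {k a b : ℕ} {S : Set G}
    (h : IsSlowGenSet k S) (hab : a + b ≤ k) {A : Subgroup G} [A.Normal] {V : Type*}
    [AddCommGroup V] (ρ : Representation ℤ G V) (π : Additive A →+ V)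
    (hπ : ∀ (g : G) (a : A), π (.ofMul (MulAut.conjNormal g a)) = ρ g (π (.ofMul a)))
    {x : G} (hx : x ∈ S ^ a) {c : A} (hc : (c : G) ∈ S ^ b) :
    ∃ p : Polynomial ℤ, Polynomial.aeval (ρ x) p (π (.ofMul c)) = 0 ∧
      ∀ μ : ℂ, 2 ≤ ‖μ‖ → Polynomial.aeval μ p ≠ 0 := by
  have hmono : ∀ {i}, i ≤ k → S ^ i ⊆ S ^ k := fun hi =>
    Set.pow_subset_pow_right h.one_mem hi
  obtain ⟨l, l', hlen, hne, heq⟩ := h.exists_collision (a := c * x) (b := x)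
    (Set.pow_subset_pow_right h.one_mem ((add_comm b a).trans_le hab)
      (by rw [pow_add]; exact Set.mul_mem_mul hc hx)) (hmono (by omega) hx)
  obtain ⟨u, hu, hπu⟩ := boolWord_eq_mul ρ π hπ x c l
  obtain ⟨v, hv, hπv⟩ := boolWord_eq_mul ρ π hπ x c l'
  have huv : u = v := by
    refine Subtype.ext (mul_right_cancel (b := x ^ l.length) ?_)
    rw [← hu, hlen, ← hv]
    exact heq
  refine ⟨Polynomial.boolPoly l - Polynomial.boolPoly l', ?_, fun μ hμ h0 => ?_⟩
  · rw [map_sub, LinearMap.sub_apply, ← hπu, ← hπv, huv, sub_self]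
  · have := Polynomial.one_le_norm_aeval_boolPoly_sub hμ l l' hlen hne
    rw [h0, norm_zero] at this
    norm_num at this

open Module in
/-- If the translates of `Z` span an `n`-dimensional representation, then so do the translates by
elements of length at most `n`. -/
theorem Representation.span_pow_finrank_eq_top {K G W : Type*} [Field K] [Group G] [AddCommGroup W]
    [Module K W] [FiniteDimensional K W] (σ : Representation K G W) {S : Set G} (h1 : (1 : G) ∈ S)
    (hinv : ∀ x ∈ S, x⁻¹ ∈ S) (hS : Subgroup.closure S = ⊤) (Z : Set W)
    (hZ : Submodule.span K (Set.image2 (fun g z => σ g z) Set.univ Z) = ⊤) :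
    Submodule.span K (Set.image2 (fun g z => σ g z) (S ^ finrank K W) Z) = ⊤ := by
  set U : ℕ → Submodule K W := fun l =>
    Submodule.span K (Set.image2 (fun g z => σ g z) (S ^ l) Z) with hU
  have hmono : Monotone U := fun i j hij =>
    Submodule.span_mono (Set.image2_subset_right (Set.pow_subset_pow_right h1 hij))
  have hstep : ∀ {l} {y : G} {w : W}, y ∈ S → w ∈ U l → σ y w ∈ U (l + 1) := by
    intro l y w hy hw
    have : U l ≤ (U (l + 1)).comap (σ y) := by
      refine Submodule.span_le.2 ?_
      rintro _ ⟨g, hg, z, hz, rfl⟩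
      refine Submodule.subset_span ⟨y * g, ?_, z, hz, by simp⟩
      rw [pow_succ']
      exact Set.mul_mem_mul hy hg
    exact this hw
  have hstable : ∀ {l}, U (l + 1) ≤ U l → U l = ⊤ := by
    intro l hl
    have hall : ∀ m, U m ≤ U l := by
      intro m
      induction m with
      | zero => exact hmono (Nat.zero_le l)
      | succ m ih =>
        refine Submodule.span_le.2 ?_
        rintro _ ⟨g, hg, z, hz, rfl⟩
        rw [pow_succ'] at hg
        obtain ⟨y, hy, g, hg, rfl⟩ := hg
        have := hl (hstep hy (ih (Submodule.subset_span ⟨g, hg, z, hz, rfl⟩)))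
        simpa using this
    rw [eq_top_iff, ← hZ]
    refine Submodule.span_le.2 ?_
    rintro _ ⟨g, -, z, hz, rfl⟩
    obtain ⟨m, hm⟩ := Set.exists_mem_pow_of_closure_eq_top hinv hS g
    exact hall m (Submodule.subset_span ⟨g, hm, z, hz, rfl⟩)
  by_contra hne
  have hlt : ∀ l, l ≤ finrank K W → l ≤ finrank K (U l) := by
    intro l
    induction l with
    | zero => exact fun _ => Nat.zero_le _
    | succ l ih =>
      intro hl
      refine Nat.succ_le_of_lt ((ih (Nat.le_of_succ_le hl)).trans_lt ?_)
      refine Submodule.finrank_lt_finrank_of_lt ((hmono (Nat.le_succ l)).lt_of_not_ge fun h => ?_)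
      exact hne (top_le_iff.1 ((hstable h).ge.trans (hmono (Nat.le_of_succ_le hl))))
  exact hne (Submodule.eq_top_of_finrank_eq
    (le_antisymm (Submodule.finrank_le _) (hlt _ le_rfl)))

open TensorProduct in
theorem span_baseChange_eq_top {G : Type*} [Group G] {T : Set G} (hT : Subgroup.closure T = ⊤)
    {s : ℕ} {V : Type*} [AddCommGroup V] (ρ : Representation ℤ G V)
    (π : Additive ((⊤ : Subgroup G).lowerCentralSeries s) →+ V) (hsurj : Function.Surjective π)
    (hπ : ∀ g a, π (.ofMul (MulAut.conjNormal g a)) = ρ g (π (.ofMul a)))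
    (K : Type*) [Field K] (σ : Representation K G (K ⊗[ℤ] V))
    (hσ : ∀ g, σ g = (ρ g).baseChange K) :
    Submodule.span K (Set.image2 (fun g z => σ g z) Set.univ
      ((fun a => (1 : K) ⊗ₜ[ℤ] π (.ofMul a)) ''
        (Subtype.val ⁻¹' Subgroup.leftNormedCommutators T s))) = ⊤ := by
  set U := Submodule.span K (Set.image2 (fun g z => σ g z) Set.univ
      ((fun a => (1 : K) ⊗ₜ[ℤ] π (.ofMul a)) ''
        (Subtype.val ⁻¹' Subgroup.leftNormedCommutators T s))) with hU
  have hmem : ∀ a : (⊤ : Subgroup G).lowerCentralSeries s, (1 : K) ⊗ₜ[ℤ] π (.ofMul a) ∈ U := by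
    rintro ⟨a, ha⟩
    have hA := Subgroup.lowerCentralSeries_eq_normalClosure hT s
    have ha' := ha
    rw [hA, Subgroup.normalClosure] at ha'
    induction ha' using Subgroup.closure_induction with
    | mem x hx =>
      obtain ⟨z, hz, hzx⟩ := Group.mem_conjugatesOfSet_iff.1 hx
      obtain ⟨g, rfl⟩ := isConj_iff.1 hzx
      have hzA := Subgroup.leftNormedCommutators_subset_lowerCentralSeries s hz
      refine Submodule.subset_span ⟨g, Set.mem_univ g, _, ⟨⟨z, hzA⟩, hz, rfl⟩, ?_⟩
      simp only [hσ, LinearMap.baseChange_tmul, ← hπ]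
      rfl
    | one =>
      have : (1 : K) ⊗ₜ[ℤ] π 0 ∈ U := by simp
      exact this
    | mul x y hx hy ihx ihy =>
      rw [← Subgroup.normalClosure, ← hA] at hx hy
      have := add_mem (ihx hx) (ihy hy)
      rw [← TensorProduct.tmul_add, ← map_add] at this
      exact this
    | inv x hx ihx =>
      rw [← Subgroup.normalClosure, ← hA] at hx
      have := neg_mem (ihx hx)
      rw [← TensorProduct.tmul_neg, ← map_neg] at this
      exact this
  rw [eq_top_iff]
  rintro w -
  induction w using TensorProduct.induction_on with
  | zero => exact zero_mem U
  | tmul r v =>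
    obtain ⟨a, rfl⟩ := hsurj v
    have := U.smul_mem r (hmem a.toMul)
    rwa [TensorProduct.smul_tmul', smul_eq_mul, mul_one] at this
  | add v w hv hw => exact add_mem hv hw

open TensorProduct Polynomial in
theorem HasSlowGenSets.exists_isNilpotent_pow_sub_one_of_free {G : Type*} [Group G]
    (hG : HasSlowGenSets G) {s : ℕ} {V : Type*} [AddCommGroup V] [Module.Finite ℤ V]
    [Module.Free ℤ V] (ρ : Representation ℤ G V)
    (π : Additive ((⊤ : Subgroup G).lowerCentralSeries s) →+ V) (hsurj : Function.Surjective π)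
    (hπ : ∀ g a, π (.ofMul (MulAut.conjNormal g a)) = ρ g (π (.ofMul a))) :
    ∃ D, 0 < D ∧ ∃ S : Set G, S.Finite ∧ Subgroup.closure S = ⊤ ∧
      ∀ x ∈ S, IsNilpotent (ρ x ^ D - 1) := by
  set n := Module.finrank ℤ V with hn
  obtain ⟨k, D, hD, hkD⟩ := Polynomial.exists_pow_eq_one_of_norm_pow_lt_two n
  obtain ⟨S, hS⟩ := hG (k + (n + 4 ^ s + n))
  refine ⟨D, hD, S, hS.finite, hS.closure_eq, fun x hx => ?_⟩
  let σ : Representation ℂ G (ℂ ⊗[ℤ] V) :=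
    (Module.End.baseChangeHom ℤ ℂ V : _ →* Module.End ℂ (ℂ ⊗[ℤ] V)).comp ρ
  have hσ : ∀ g, σ g = (ρ g).baseChange ℂ := fun g => rfl
  have hspan := σ.span_pow_finrank_eq_top hS.one_mem hS.inv_mem hS.closure_eq _
    (span_baseChange_eq_top hS.closure_eq ρ π hsurj hπ ℂ σ hσ)
  rw [Module.finrank_baseChange, ← hn] at hspan
  have hann : ∀ c : (⊤ : Subgroup G).lowerCentralSeries s, ∃ p : ℤ[X],
      ((c : G) ∈ S ^ (n + 4 ^ s + n) → aeval (ρ (x ^ k)) p (π (.ofMul c)) = 0) ∧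
        ∀ μ : ℂ, 2 ≤ ‖μ‖ → aeval μ p ≠ 0 := by
    intro c
    by_cases hc : (c : G) ∈ S ^ (n + 4 ^ s + n)
    · obtain ⟨p, hp, hp2⟩ := hS.exists_aeval_eq_zero le_rfl ρ π hπ (Set.pow_mem_pow hx) hc
      exact ⟨p, fun _ => hp, hp2⟩
    · exact ⟨1, fun h => absurd h hc, by simp⟩
  choose p hp hp2 using hann
  have hfin : {c : (⊤ : Subgroup G).lowerCentralSeries s | (c : G) ∈ S ^ (n + 4 ^ s + n)}.Finite :=
    (hS.finite.pow_of_group _).preimage Subtype.val_injective.injOn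
  set P := ∏ c ∈ hfin.toFinset, p c with hP
  have hPx : aeval (σ (x ^ k)) P = 0 := by
    have hP' : aeval (σ (x ^ k)) P = (aeval (ρ (x ^ k)) P).baseChange ℂ :=
      aeval_algHom_apply (Module.End.baseChangeHom ℤ ℂ V) (ρ (x ^ k)) P
    rw [← LinearMap.ker_eq_top, eq_top_iff, ← hspan, Submodule.span_le]
    rintro _ ⟨g, hg, _, ⟨a, ha, rfl⟩, rfl⟩
    have hc : (MulAut.conjNormal g a : G) ∈ S ^ (n + 4 ^ s + n) := by
      rw [MulAut.conjNormal_apply, pow_add, pow_add]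
      exact Set.mul_mem_mul (Set.mul_mem_mul hg
        (Subgroup.leftNormedCommutators_subset_pow hS.one_mem hS.inv_mem s ha))
        (Set.inv_mem_pow hS.inv_mem g hg)
    obtain ⟨q, hq⟩ := Finset.dvd_prod_of_mem p (hfin.mem_toFinset.2 hc)
    rw [SetLike.mem_coe, LinearMap.mem_ker, hP']
    simp only [hσ, LinearMap.baseChange_tmul, ← hπ]
    rw [hP, hq, mul_comm, map_mul, Module.End.mul_apply, hp _ hc, map_zero, tmul_zero]
  have heigen : ∀ z : ℂ, z ∈ ((ρ x).charpoly.map (Int.castRingHom ℂ)).roots →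
      Module.End.HasEigenvalue (σ x) z := by
    intro z hz
    rw [Module.End.hasEigenvalue_iff_isRoot_charpoly, hσ, LinearMap.charpoly_baseChange]
    exact (mem_roots'.1 hz).2
  have hroots : ∀ z ∈ ((ρ x).charpoly.map (Int.castRingHom ℂ)).roots, ‖z‖ ^ k < 2 := by
    intro z hz
    obtain ⟨w, hw⟩ := (heigen z hz).exists_hasEigenvector
    have hwk : Module.End.HasEigenvector (σ (x ^ k)) (z ^ k) w := by
      refine ⟨Module.End.mem_eigenspace_iff.2 ?_, hw.2⟩
      rw [map_pow, hw.pow_apply]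
    have h0 : aeval (z ^ k) P = 0 := by
      have := Module.End.aeval_apply_of_hasEigenvector (p := P.map (Int.castRingHom ℂ)) hwk
      rw [← algebraMap_int_eq, aeval_map_algebraMap, hPx, LinearMap.zero_apply,
        eval_map_algebraMap] at this
      exact (smul_eq_zero.1 this.symm).resolve_right hw.2
    rw [hP, map_prod, Finset.prod_eq_zero_iff] at h0
    obtain ⟨c, -, hc⟩ := h0
    rw [← norm_pow]
    exact not_le.1 fun h => hp2 c _ h hc
  have hcoeff : (ρ x).charpoly.coeff 0 ≠ 0 := by
    intro h0
    have hroot : (0 : ℂ) ∈ ((ρ x).charpoly.map (Int.castRingHom ℂ)).roots := by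
      rw [mem_roots ((ρ x).charpoly_monic.map _).ne_zero, IsRoot.def, ← coeff_zero_eq_eval_zero,
        coeff_map, h0, map_zero]
    obtain ⟨w, hw⟩ := (heigen 0 hroot).exists_hasEigenvector
    refine hw.2 ?_
    rw [← σ.inv_self_apply x w, hw.apply_eq_smul, zero_smul, map_zero]
  have hdvd : (ρ x).charpoly ∣ (X ^ D - 1) ^ n := by
    rw [← map_dvd_map (Int.castRingHom ℂ) Int.cast_injective (ρ x).charpoly_monic]
    have := ((ρ x).charpoly_monic.map (Int.castRingHom ℂ)).dvd_X_pow_sub_one_pow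
      (hkD _ (ρ x).charpoly_monic (ρ x).charpoly_natDegree hcoeff hroots)
    rw [(ρ x).charpoly_monic.natDegree_map, (ρ x).charpoly_natDegree] at this
    simpa using this
  obtain ⟨q, hq⟩ := hdvd
  refine ⟨n, ?_⟩
  have := congrArg (aeval (ρ x)) hq
  rw [map_mul, LinearMap.aeval_self_charpoly, zero_mul] at this
  simpa using this

theorem IsNilpotent.pow_sub_one {R : Type*} [Ring R] {u : R} (h : IsNilpotent (u - 1)) (e : ℕ) :
    IsNilpotent (u ^ e - 1) := by
  rw [← geom_sum_mul]
  refine Commute.isNilpotent_mul_left (Commute.sum_left _ _ _ fun i _ => ?_) h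
  exact (((Commute.refl u).sub_right (Commute.one_right u))).pow_left i

theorem HasSlowGenSets.exists_isNilpotent_pow_sub_one {G : Type*} [Group G]
    (hG : HasSlowGenSets G) {s : ℕ} {V : Type*} [AddCommGroup V] [Module.Finite ℤ V]
    (ρ : Representation ℤ G V)
    (π : Additive ((⊤ : Subgroup G).lowerCentralSeries s) →+ V) (hsurj : Function.Surjective π)
    (hπ : ∀ g a, π (.ofMul (MulAut.conjNormal g a)) = ρ g (π (.ofMul a))) :
    ∃ D, 0 < D ∧ ∃ S : Set G, S.Finite ∧ Subgroup.closure S = ⊤ ∧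
      ∀ x ∈ S, IsNilpotent (ρ x ^ D - 1) := by
  set T := Submodule.torsion ℤ V with hT
  have hTρ : ∀ g, T ≤ T.comap (ρ g) := by
    rintro g v ⟨a, hav⟩
    refine ⟨a, ?_⟩
    rw [Submonoid.smul_def] at hav ⊢
    rw [← map_smul, hav, map_zero]
  obtain ⟨D, hD, S, hSfin, hS, hnil⟩ := hG.exists_isNilpotent_pow_sub_one_of_free
    (ρ.quotient T hTρ) (T.mkQ.toAddMonoidHom.comp π) (T.mkQ_surjective.comp hsurj)
    fun g a => by simp [hπ]
  have : Finite T := Module.finite_of_fg_torsion T Submodule.torsion_isTorsion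
  have : Finite (Module.End ℤ T) := DFunLike.finite _
  set e := Nat.card (Module.End ℤ T)ˣ with he
  have hfix : ∀ x, ∀ v ∈ T, (ρ x ^ e) v = v := by
    intro x v hv
    have h1 : (ρ.subrepresentation T hTρ).toHomUnits x ^ e = 1 := pow_card_eq_one'
    have h2 := congrArg (fun u : (Module.End ℤ T)ˣ => ((u : Module.End ℤ T) ⟨v, hv⟩ : V)) h1
    simp only [← map_pow, MonoidHom.coe_toHomUnits] at h2
    rw [← map_pow]
    exact h2
  refine ⟨D * e, Nat.mul_pos hD Nat.card_pos, S, hSfin, hS, fun x hx => ?_⟩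
  obtain ⟨m, hm⟩ := (hnil x hx).pow_sub_one e
  rw [← pow_mul] at hm
  have hmT : ∀ v, ((ρ x ^ (D * e) - 1 : Module.End ℤ V) ^ m) v ∈ T := by
    intro v
    have hcomm : ∀ i v, T.mkQ (((ρ x ^ (D * e) - 1 : Module.End ℤ V) ^ i) v) =
        ((ρ.quotient T hTρ x ^ (D * e) - 1 : Module.End ℤ (V ⧸ T)) ^ i) (T.mkQ v) := by
      intro i
      induction i with
      | zero => simp
      | succ i ih =>
        intro v
        rw [pow_succ', pow_succ', Module.End.mul_apply, Module.End.mul_apply, ← ih, ← map_pow,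
          ← map_pow]
        simp
    have := hcomm m v
    rwa [hm, LinearMap.zero_apply, Submodule.mkQ_apply, Submodule.Quotient.mk_eq_zero] at this
  refine ⟨m + 1, LinearMap.ext fun v => ?_⟩
  rw [pow_succ', Module.End.mul_apply, LinearMap.sub_apply, pow_mul, ← map_pow ρ x D,
    hfix _ _ (by simpa [pow_mul] using hmT v)]
  exact sub_self _

theorem isNilpotent_map_commutatorElement_sub_one {Γ R : Type*} [Group Γ] [Ring R] (τ : Γ →* R)
    {a y : Γ} (hcomm : ∀ g, Commute (τ ⁅a, y⁆) (τ g)) (hy : IsNilpotent (τ y - 1)) :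
    IsNilpotent (τ ⁅a, y⁆ - 1) := by
  have hconj : IsNilpotent (τ (a * y * a⁻¹) - 1) := by
    obtain ⟨n, hn⟩ := hy
    refine ⟨n, ?_⟩
    have h : τ (a * y * a⁻¹) - 1 =
        τ.toHomUnits a * (τ y - 1) * ((τ.toHomUnits a)⁻¹ : Rˣ) := by
      rw [mul_sub, mul_one, sub_mul, Units.mul_inv, map_mul, map_mul]
      rfl
    rw [h, Units.conj_pow, hn, mul_zero, zero_mul]
  have hzy : τ (a * y * a⁻¹) = τ ⁅a, y⁆ * τ y := by
    rw [← map_mul, commutatorElement_def, inv_mul_cancel_right]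
  have h1 : Commute (τ (a * y * a⁻¹)) (τ y) := hzy ▸ (hcomm y).mul_left (.refl _)
  have h : τ ⁅a, y⁆ - 1 = (τ (a * y * a⁻¹) - 1 - (τ y - 1)) * τ y⁻¹ := by
    rw [sub_sub_sub_cancel_right, sub_mul, ← map_mul, ← map_mul, mul_inv_cancel, map_one,
      commutatorElement_def]
  rw [h]
  have h2 : Commute (τ y) (τ y⁻¹) := by
    rw [commute_iff_eq, ← map_mul, ← map_mul, mul_inv_cancel, inv_mul_cancel]
  refine Commute.isNilpotent_mul_right ?_ (Commute.isNilpotent_sub ?_ hconj hy)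
  · rw [sub_sub_sub_cancel_right, hzy]
    exact ((hcomm _).mul_left h2).sub_left h2
  · exact ((h1.sub_right (.one_right _)).sub_left ((Commute.one_left _)))

namespace Representation

variable {Γ V : Type*} [Group Γ] [AddCommGroup V]

theorem exists_ne_zero_mem_fixed {ρ : Representation ℤ Γ V} {U : Submodule ℤ V} (hU : U ≠ ⊥)
    (hinv : ∀ g, U ≤ U.comap (ρ g)) {z : Γ}
    (hz : IsNilpotent (ρ.subrepresentation U hinv z - 1)) :
    ∃ v ∈ U, v ≠ 0 ∧ ρ z v = v := by
  obtain ⟨n, hn⟩ := hz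
  have : Nontrivial U := Submodule.nontrivial_iff_ne_bot.2 hU
  obtain ⟨u, hu⟩ := exists_ne (0 : U)
  replace hn := LinearMap.congr_fun hn u
  induction n generalizing u with
  | zero => exact absurd hn hu
  | succ n ih =>
    by_cases h : (ρ.subrepresentation U hinv z - 1) u = 0
    · exact ⟨u, u.2, fun h0 => hu (Subtype.ext h0), sub_eq_zero.1 (congrArg Subtype.val h)⟩
    · exact ih _ h (by rwa [pow_succ] at hn)

/-- The vectors of `U` fixed by a set of group elements. -/
def fixedBy (ρ : Representation ℤ Γ V) (Z : Set Γ) : Submodule ℤ V where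
  carrier := {v | ∀ z ∈ Z, ρ z v = v}
  add_mem' hv hw z hz := by rw [map_add, hv z hz, hw z hz]
  zero_mem' z _ := map_zero _
  smul_mem' c v hv z hz := by rw [map_smul, hv z hz]

theorem fixedBy_closure (ρ : Representation ℤ Γ V) (Z : Set Γ) :
    ρ.fixedBy (Subgroup.closure Z) = ρ.fixedBy Z := by
  refine le_antisymm (fun v hv z hz => hv z (Subgroup.subset_closure hz)) fun v hv z hz => ?_
  induction hz using Subgroup.closure_induction with
  | one => simp
  | mem z hz => exact hv z hz
  | mul a b _ _ ha hb => rw [map_mul, Module.End.mul_apply, hb, ha]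
  | inv a _ ha =>
    conv_lhs => rw [← ha]
    rw [← Module.End.mul_apply, ← map_mul, inv_mul_cancel, map_one, Module.End.one_apply]

theorem fixedBy_sup (ρ : Representation ℤ Γ V) (H K : Subgroup Γ) :
    ρ.fixedBy (H ⊔ K : Subgroup Γ) = ρ.fixedBy H ⊓ ρ.fixedBy K := by
  rw [Subgroup.sup_eq_closure, fixedBy_closure]
  refine le_antisymm (fun v hv => ⟨fun z hz => hv z (.inl hz), fun z hz => hv z (.inr hz)⟩) ?_
  rintro v ⟨h1, h2⟩ z (hz | hz)
  exacts [h1 z hz, h2 z hz]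

theorem apply_comm_of_mem_fixedBy {ρ : Representation ℤ Γ V} {i : ℕ} {v : V}
    (hv : v ∈ ρ.fixedBy ((⊤ : Subgroup Γ).lowerCentralSeries (i + 1))) {z : Γ}
    (hz : z ∈ (⊤ : Subgroup Γ).lowerCentralSeries i) (g : Γ) : ρ z (ρ g v) = ρ g (ρ z v) := by
  have h := hv ⁅z⁻¹, g⁻¹⁆ (Subgroup.commutator_mem_commutator (inv_mem hz) (Subgroup.mem_top _))
  conv_rhs => rw [← h]
  rw [← Module.End.mul_apply, ← Module.End.mul_apply, ← Module.End.mul_apply, ← map_mul, ← map_mul,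
    ← map_mul]
  congr 2
  simp [commutatorElement_def, mul_assoc]

/-- A finitely generated group acting through a nilpotent quotient, and generated by elements
acting unipotently, has a nonzero fixed vector. -/
theorem exists_ne_zero_forall_apply_eq {T : Set Γ} (hTfin : T.Finite)
    (hT : Subgroup.closure T = ⊤) (ρ : Representation ℤ Γ V)
    (hunip : ∀ y ∈ T, IsNilpotent (ρ y - 1)) {s : ℕ}
    (hs : ∀ g ∈ (⊤ : Subgroup Γ).lowerCentralSeries s, ρ g = 1) [Nontrivial V] :
    ∃ v ≠ 0, ∀ g, ρ g v = v := by
  suffices key : ∀ i ≤ s, ρ.fixedBy ((⊤ : Subgroup Γ).lowerCentralSeries i) ≠ ⊥ by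
    obtain ⟨v, hv, hv0⟩ := (Submodule.ne_bot_iff _).1 (key 0 s.zero_le)
    exact ⟨v, hv0, fun g => hv g (Subgroup.mem_top g)⟩
  intro i hi
  induction hi using Nat.decreasingInduction with
  | self =>
    obtain ⟨v, hv⟩ := exists_ne (0 : V)
    exact (Submodule.ne_bot_iff _).2 ⟨v, fun g hg => by rw [hs g hg, Module.End.one_apply], hv⟩
  | of_succ i _ ih =>
    set W := ρ.fixedBy ((⊤ : Subgroup Γ).lowerCentralSeries (i + 1)) with hW
    have hWinv : ∀ g, W ≤ W.comap (ρ g) := by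
      intro g v hv c hc
      have h := hv (g⁻¹ * c * g) (by simpa using Subgroup.Normal.conj_mem inferInstance c hc g⁻¹)
      conv_rhs => rw [← h]
      rw [← Module.End.mul_apply, ← Module.End.mul_apply, ← map_mul, ← map_mul, mul_assoc g⁻¹,
        mul_inv_cancel_left]
    suffices key : ∀ Z ⊆ Subgroup.leftNormedCommutators T i, Z.Finite → W ⊓ ρ.fixedBy Z ≠ ⊥ by
      rw [Subgroup.lowerCentralSeries_eq_closure_sup hT i, fixedBy_sup, fixedBy_closure, inf_comm]
      exact key _ subset_rfl (Subgroup.finite_leftNormedCommutators hTfin i)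
    intro Z hZ hZfin
    induction Z, hZfin using Set.Finite.induction_on with
    | empty =>
      have : ρ.fixedBy ∅ = ⊤ := eq_top_iff.2 fun v _ z hz => hz.elim
      rwa [this, inf_top_eq]
    | @insert z Z _ _ ihZ =>
      rw [Set.insert_subset_iff] at hZ
      have hmem : ∀ z ∈ Subgroup.leftNormedCommutators T i,
          z ∈ (⊤ : Subgroup Γ).lowerCentralSeries i :=
        fun z hz => Subgroup.leftNormedCommutators_subset_lowerCentralSeries i hz
      have hinv : ∀ g, W ⊓ ρ.fixedBy Z ≤ (W ⊓ ρ.fixedBy Z).comap (ρ g) := by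
        rintro g v ⟨hv, hvZ⟩
        refine ⟨hWinv g hv, fun w hw => ?_⟩
        rw [apply_comm_of_mem_fixedBy hv (hmem w (hZ.2 hw)), hvZ w hw]
      have hnil : IsNilpotent (ρ.subrepresentation _ hinv z - 1) := by
        have hgen : ∀ y ∈ T, IsNilpotent (ρ.subrepresentation _ hinv y - 1) :=
          fun y hy => Module.End.isNilpotent.restrict
            (fun v hv => Submodule.sub_mem (W ⊓ ρ.fixedBy Z) (hinv y hv) hv) (hunip y hy)
        cases i with
        | zero => exact hgen z hZ.1
        | succ i =>
          obtain ⟨a, -, y, hy, rfl⟩ := hZ.1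
          refine isNilpotent_map_commutatorElement_sub_one _ (fun g => ?_) (hgen y hy)
          refine LinearMap.ext fun v => Subtype.ext ?_
          exact apply_comm_of_mem_fixedBy v.2.1 (hmem _ hZ.1) g
      obtain ⟨v, hv, hv0, hvz⟩ := exists_ne_zero_mem_fixed (ihZ hZ.2) hinv hnil
      refine (Submodule.ne_bot_iff _).2 ⟨v, ⟨hv.1, ?_⟩, hv0⟩
      rintro w (rfl | hw)
      exacts [hvz, hv.2 w hw]

/-- The ascending series of iterated fixed vectors. -/
def fixedSeries (ρ : Representation ℤ Γ V) : ℕ → Submodule ℤ V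
  | 0 => ⊥
  | j + 1 => ⨅ g, (ρ.fixedSeries j).comap (ρ g - 1)

theorem mem_fixedSeries_succ {ρ : Representation ℤ Γ V} {j : ℕ} {v : V} :
    v ∈ ρ.fixedSeries (j + 1) ↔ ∀ g, ρ g v - v ∈ ρ.fixedSeries j := by
  simp [fixedSeries]

theorem fixedSeries_le_comap (ρ : Representation ℤ Γ V) (j : ℕ) (g : Γ) :
    ρ.fixedSeries j ≤ (ρ.fixedSeries j).comap (ρ g) := by
  cases j with
  | zero => simp [fixedSeries]
  | succ j =>
    intro v hv
    rw [mem_fixedSeries_succ] at hv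
    rw [Submodule.mem_comap, mem_fixedSeries_succ]
    intro h
    have := sub_mem (hv (h * g)) (hv g)
    rwa [sub_sub_sub_cancel_right, map_mul, Module.End.mul_apply] at this

theorem fixedSeries_mono (ρ : Representation ℤ Γ V) : Monotone ρ.fixedSeries :=
  monotone_nat_of_le_succ fun j _ hv => mem_fixedSeries_succ.2 fun g =>
    sub_mem (ρ.fixedSeries_le_comap j g hv) hv

theorem exists_fixedSeries_eq_top [IsNoetherian ℤ V] {T : Set Γ} (hTfin : T.Finite)
    (hT : Subgroup.closure T = ⊤) (ρ : Representation ℤ Γ V)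
    (hunip : ∀ y ∈ T, IsNilpotent (ρ y - 1)) {s : ℕ}
    (hs : ∀ g ∈ (⊤ : Subgroup Γ).lowerCentralSeries s, ρ g = 1) :
    ∃ m, ρ.fixedSeries m = ⊤ := by
  obtain ⟨m, hm⟩ := monotone_stabilizes_iff_noetherian.2 ‹IsNoetherian ℤ V›
    ⟨ρ.fixedSeries, ρ.fixedSeries_mono⟩
  refine ⟨m, ?_⟩
  by_contra hne
  have : Nontrivial (V ⧸ ρ.fixedSeries m) := Submodule.Quotient.nontrivial_iff.2 hne
  have hσ := ρ.fixedSeries_le_comap m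
  have hunip' : ∀ y ∈ T, IsNilpotent (ρ.quotient _ hσ y - 1) := fun y hy => by
    have h : ρ.fixedSeries m ≤ (ρ.fixedSeries m).comap (ρ y - 1) :=
      fun v hv => Submodule.sub_mem _ (hσ y hv) hv
    convert Module.End.IsNilpotent.mapQ h (hunip y hy) using 1
    refine LinearMap.ext fun v => ?_
    obtain ⟨v, rfl⟩ := Submodule.mkQ_surjective _ v
    rfl
  have hs' : ∀ g ∈ (⊤ : Subgroup Γ).lowerCentralSeries s, ρ.quotient _ hσ g = 1 := fun g hg => by
    refine LinearMap.ext fun v => ?_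
    obtain ⟨v, rfl⟩ := Submodule.mkQ_surjective _ v
    simp [hs g hg]
  obtain ⟨v, hv0, hv⟩ := exists_ne_zero_forall_apply_eq hTfin hT (ρ.quotient _ hσ) hunip' hs'
  obtain ⟨v, rfl⟩ := Submodule.mkQ_surjective _ v
  refine hv0 ((Submodule.Quotient.mk_eq_zero _).2 ?_)
  have : ρ.fixedSeries m = ρ.fixedSeries (m + 1) := hm (m + 1) m.le_succ
  rw [this, mem_fixedSeries_succ]
  exact fun g => (Submodule.Quotient.eq _).1 (hv g)

end Representation

/-- The conjugation action of a group on the abelianization of a normal subgroup. -/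
def Subgroup.conjAbelianization {G : Type*} [Group G] (A : Subgroup G) [A.Normal] :
    Representation ℤ G (Additive (Abelianization A)) where
  toFun g := (MonoidHom.toAdditive
    (Abelianization.map (MulAut.conjNormal g : MulAut A).toMonoidHom)).toIntLinearMap
  map_one' := by
    refine LinearMap.ext fun v => ?_
    obtain ⟨a, rfl⟩ := QuotientGroup.mk_surjective v
    exact congrArg (fun b : A => Additive.ofMul (Abelianization.of b)) (by simp)
  map_mul' g h := by
    refine LinearMap.ext fun v => ?_
    obtain ⟨a, rfl⟩ := QuotientGroup.mk_surjective v
    exact congrArg (fun b : A => Additive.ofMul (Abelianization.of b)) (by simp)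

theorem HasSlowGenSets.exists_lowerCentralSeries_le_commutator {G : Type*} [Group G]
    (hG : HasSlowGenSets G) (s : ℕ) : ∃ K : Subgroup G, K.FiniteIndex ∧ ∃ t,
      K.lowerCentralSeries t ≤ (commutator ((⊤ : Subgroup G).lowerCentralSeries s)).map
        (Subgroup.subtype _) := by
  set A := (⊤ : Subgroup G).lowerCentralSeries s with hA
  have : Group.FG A := (Group.fg_iff_subgroup_fg _).2 (hG.fg_of_lowerCentralSeries_le le_rfl)
  have : Module.Finite ℤ (Additive (Abelianization A)) :=
    Module.Finite.iff_addGroup_fg.2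
      (AddGroup.fg_iff_mul_fg.2 (QuotientGroup.fg (commutator A)))
  set ρ := A.conjAbelianization with hρ
  set π : Additive A →+ Additive (Abelianization A) := MonoidHom.toAdditive Abelianization.of
  have hπ : ∀ g a, π (.ofMul (MulAut.conjNormal g a)) = ρ g (π (.ofMul a)) := fun _ _ => rfl
  have hsurj : Function.Surjective π := QuotientGroup.mk'_surjective (commutator A)
  have hρA : ∀ a ∈ A, ρ a = 1 := by
    intro a ha
    refine LinearMap.ext fun v => ?_
    obtain ⟨b, rfl⟩ := hsurj v
    have : MulAut.conjNormal a b.toMul = (⟨a, ha⟩ * b.toMul * ⟨a, ha⟩⁻¹ : A) :=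
      Subtype.ext (by simp)
    rw [← ofMul_toMul b, ← hπ, this, ofMul_mul, ofMul_mul, ofMul_inv, map_add, map_add, map_neg,
      add_neg_cancel_comm]
    rfl
  obtain ⟨D, hD, S, hSfin, hS, hnil⟩ := hG.exists_isNilpotent_pow_sub_one ρ π hsurj hπ
  set X : Set G := (· ^ D) '' S with hX
  set L := Subgroup.closure X with hL
  have hXL : ∀ x ∈ S, x ^ D ∈ L := fun x hx => Subgroup.subset_closure ⟨x, hx, rfl⟩
  obtain ⟨m, hm⟩ := Representation.exists_fixedSeries_eq_top
    (((hSfin.image _).preimage Subtype.val_injective.injOn : ((↑) ⁻¹' X : Set L).Finite))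
    Subgroup.closure_closure_coe_preimage (ρ.comp L.subtype)
    (by
      rintro y ⟨x, hx, hxy⟩
      have := hnil x hx
      rw [← map_pow] at this
      rw [MonoidHom.comp_apply, Subgroup.subtype_apply, ← hxy]
      exact this) (s := s)
    (fun g hg => hρA _ (Subgroup.lowerCentralSeries_mono s le_top
      (L.top_subtype_lowerCentralSeries s ▸ Subgroup.mem_map_of_mem L.subtype hg)))
  set F := Representation.fixedSeries (ρ.comp L.subtype) with hF
  have hFsucc : ∀ j v, v ∈ F (j + 1) → ∀ k ∈ L ⊔ A, ρ k v - v ∈ F j := by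
    intro j v hv k hk
    have hk' : k ∈ ((L ⊔ A : Subgroup G) : Set G) := hk
    rw [Subgroup.mul_normal] at hk'
    obtain ⟨l, hl, a, ha, rfl⟩ := hk'
    rw [map_mul, hρA a ha, mul_one]
    exact Representation.mem_fixedSeries_succ.1 hv ⟨l, hl⟩
  refine ⟨L ⊔ A, Subgroup.finiteIndex_sup_lowerCentralSeries hSfin hS hD hXL s, s + m, ?_⟩
  let B : ℕ → Subgroup A := fun i => ((F i).toAddSubgroup.comap π).toSubgroup'
  have hB : ∀ i a, a ∈ B i ↔ π (.ofMul a) ∈ F i := fun _ _ => .rfl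
  have key : ∀ j i, i + j = m → (L ⊔ A).lowerCentralSeries (s + j) ≤ (B i).map A.subtype := by
    intro j
    induction j with
    | zero =>
      rintro i rfl g hg
      exact ⟨⟨g, Subgroup.lowerCentralSeries_mono s le_top hg⟩, (hB _ _).2 (hm ▸ Submodule.mem_top),
        rfl⟩
    | succ j ih =>
      intro i hi
      refine (Subgroup.commutator_mono (ih (i + 1) (by omega)) le_rfl).trans ?_
      rw [Subgroup.commutator_le]
      rintro _ ⟨a, ha, rfl⟩ k hk
      refine ⟨a * MulAut.conjNormal k a⁻¹, (hB _ _).2 ?_,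
        by simp [commutatorElement_def, mul_assoc]⟩
      rw [ofMul_mul, map_add, hπ, ofMul_inv, map_neg, map_neg, ← sub_eq_add_neg, ← neg_sub]
      exact neg_mem (hFsucc i _ ((hB _ _).1 ha) k hk)
  intro g hg
  obtain ⟨a, ha, rfl⟩ := key m 0 (zero_add m) hg
  exact ⟨a, (QuotientGroup.eq_one_iff a).1 ha, rfl⟩

/-- The smallest class of groups containing the trivial groups and closed under extensions by
abelian groups and by finite groups and under directed unions. -/
inductive ElementaryClass : (G : Type u) → Group G → Prop
  | trivial (G : Type u) [inst : Group G] (h : Subsingleton G) : ElementaryClass G inst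
  | abelianExtension {G : Type u} [inst : Group G] (N : Subgroup G) (hN : commutator G ≤ N)
      (h : ElementaryClass N inferInstance) : ElementaryClass G inst
  | finiteExtension {G : Type u} [inst : Group G] (N : Subgroup G) (hN : N.FiniteIndex)
      (h : ElementaryClass N inferInstance) : ElementaryClass G inst
  | directedUnion {G : Type u} [inst : Group G] {ι : Type u} (K : ι → Subgroup G)
      (hdir : Directed (· ≤ ·) K) (htop : ⨆ i, K i = ⊤)
      (h : ∀ i, ElementaryClass (K i) inferInstance) : ElementaryClass G inst

theorem Subgroup.finiteIndex_comap {G H : Type*} [Group G] [Group H] (f : H →* G)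
    {N : Subgroup G} (hN : N.FiniteIndex) : (N.comap f).FiniteIndex :=
  ⟨by
    rw [Subgroup.index_comap]
    exact fun h => hN.index_ne_zero (Subgroup.index_eq_zero_of_relIndex_eq_zero h)⟩

namespace ElementaryClass

theorem subsingleton_of_iSup_eq_top {G : Type u} [Group G] {ι : Type u} [IsEmpty ι]
    {K : ι → Subgroup G} (h : ⨆ i, K i = ⊤) : Subsingleton G := by
  rw [iSup_of_empty] at h
  exact Subgroup.subsingleton_iff.1 (subsingleton_of_bot_eq_top h)

theorem iSup_comap_eq_top {G H : Type u} [Group G] [Group H] (f : H →* G) {ι : Type u}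
    [Nonempty ι] {K : ι → Subgroup G} (hdir : Directed (· ≤ ·) K) (h : ⨆ i, K i = ⊤) :
    ⨆ i, (K i).comap f = ⊤ := by
  rw [eq_top_iff]
  intro x _
  obtain ⟨i, hi⟩ := (Subgroup.mem_iSup_of_directed hdir).1 (h ▸ Subgroup.mem_top (f x))
  exact Subgroup.mem_iSup_of_mem i hi

theorem commutator_le_comap {G H : Type u} [Group G] [Group H] (f : H →* G) {N : Subgroup G}
    (hN : commutator G ≤ N) : commutator H ≤ N.comap f := by
  rw [← Subgroup.map_le_iff_le_comap]
  refine le_trans ?_ hN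
  rw [commutator_def, commutator_def, Subgroup.map_commutator]
  exact Subgroup.commutator_mono le_top le_top

theorem of_injective {G : Type u} {inst : Group G} (hG : ElementaryClass G inst) :
    ∀ {H : Type u} [Group H] (f : H →* G), Function.Injective f →
      ElementaryClass H inferInstance := by
  have hrestrict : ∀ {G : Type u} [Group G] {H : Type u} [Group H] {f : H →* G} (N : Subgroup G),
      Function.Injective f → Function.Injective (f.subgroupComap N) :=
    fun N hf x y hxy => Subtype.ext (hf (congrArg Subtype.val hxy))
  induction hG with
  | trivial G h => exact fun f hf => trivial _ hf.subsingleton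
  | abelianExtension N hN _ ih =>
    exact fun f hf => abelianExtension _ (commutator_le_comap f hN) (ih _ (hrestrict N hf))
  | finiteExtension N hN _ ih =>
    exact fun f hf => finiteExtension (N.comap f) (Subgroup.finiteIndex_comap f hN)
      (ih _ (hrestrict N hf))
  | @directedUnion _ _ ι K hdir htop _ ih =>
    intro H _ f hf
    cases isEmpty_or_nonempty ι with
    | inl _ =>
      have := subsingleton_of_iSup_eq_top htop
      exact trivial _ hf.subsingleton
    | inr _ =>
      exact directedUnion (fun i => (K i).comap f)
        (hdir.mono_comp _ fun _ _ h => Subgroup.comap_mono h)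
        (iSup_comap_eq_top f hdir htop) fun i => ih i _ (hrestrict (K i) hf)

theorem of_surjective {G : Type u} {inst : Group G} (hG : ElementaryClass G inst) :
    ∀ {H : Type u} [Group H] (f : G →* H), Function.Surjective f →
      ElementaryClass H inferInstance := by
  induction hG with
  | trivial G h => exact fun f hf => trivial _ hf.subsingleton
  | abelianExtension N hN _ ih =>
    intro H _ f hf
    refine abelianExtension (N.map f) ?_ (ih _ (f.subgroupMap_surjective N))
    refine le_trans (le_of_eq ?_) (Subgroup.map_mono hN)
    rw [commutator_def, commutator_def, Subgroup.map_commutator,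
      Subgroup.map_top_of_surjective f hf]
  | finiteExtension N hN _ ih =>
    intro H _ f hf
    refine finiteExtension (N.map f) ⟨fun h => hN.index_ne_zero ?_⟩
      (ih _ (f.subgroupMap_surjective N))
    exact Nat.eq_zero_of_zero_dvd (h ▸ N.index_map_dvd hf)
  | directedUnion K hdir htop _ ih =>
    intro H _ f hf
    refine directedUnion (fun i => (K i).map f)
      (hdir.mono_comp _ fun _ _ h => Subgroup.map_mono h) ?_
      fun i => ih i _ (f.subgroupMap_surjective (K i))
    rw [← Subgroup.map_iSup, htop, Subgroup.map_top_of_surjective f hf]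

theorem of_ker {Q : Type u} {inst : Group Q} (hQ : ElementaryClass Q inst) :
    ∀ {G : Type u} [Group G] (f : G →* Q), ElementaryClass f.ker inferInstance →
      ElementaryClass G inferInstance := by
  have hrestrict : ∀ {G : Type u} [Group G] {Q : Type u} [Group Q] {f : G →* Q} (N : Subgroup Q),
      ElementaryClass f.ker inferInstance →
        ElementaryClass (f.subgroupComap N).ker inferInstance := by
    intro G _ Q _ f N h
    refine h.of_injective (((N.comap f).subtype.comp (f.subgroupComap N).ker.subtype).codRestrict
      f.ker fun x => congrArg Subtype.val x.2) fun x y hxy => ?_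
    exact Subtype.ext (Subtype.ext (congrArg (fun a : f.ker => (a : G)) hxy))
  induction hQ with
  | trivial Q h =>
    intro G _ f hf
    refine hf.of_injective ((MonoidHom.id G).codRestrict f.ker fun x => Subsingleton.elim _ _) ?_
    exact fun x y hxy => congrArg Subtype.val hxy
  | abelianExtension N hN _ ih =>
    exact fun f hf => abelianExtension _ (commutator_le_comap f hN) (ih _ (hrestrict N hf))
  | finiteExtension N hN _ ih =>
    exact fun f hf => finiteExtension (N.comap f) (Subgroup.finiteIndex_comap f hN)
      (ih _ (hrestrict N hf))
  | @directedUnion _ _ ι K hdir htop _ ih =>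
    intro G _ f hf
    cases isEmpty_or_nonempty ι with
    | inl _ =>
      have := subsingleton_of_iSup_eq_top htop
      refine hf.of_injective ((MonoidHom.id G).codRestrict f.ker fun x => Subsingleton.elim _ _) ?_
      exact fun x y hxy => congrArg Subtype.val hxy
    | inr _ =>
      exact directedUnion (fun i => (K i).comap f)
        (hdir.mono_comp _ fun _ _ h => Subgroup.comap_mono h)
        (iSup_comap_eq_top f hdir htop) fun i => ih i _ (hrestrict (K i) hf)

theorem _root_.ElementaryAmenable.elementaryClass {G : Type u} {inst : Group G}
    (hG : ElementaryAmenable G inst) : ElementaryClass G inst := by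
  have hbot : ∀ (G : Type u) [Group G], ElementaryClass (⊥ : Subgroup G) inferInstance :=
    fun G _ => trivial _ inferInstance
  induction hG with
  | abelian G h =>
    refine abelianExtension ⊥ ?_ (hbot G)
    rw [commutator_def, Subgroup.commutator_le]
    intro a _ b _
    exact commutatorElement_eq_one_iff_mul_comm.2 (h a b)
  | finite G h => exact finiteExtension ⊥ inferInstance (hbot G)
  | subgroup f hf _ ih => exact ih.of_injective f hf
  | quotient f hf _ ih => exact ih.of_surjective f hf
  | extension N _ _ ih1 ih2 =>
    refine ih2.of_ker (QuotientGroup.mk' N) ?_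
    rwa [QuotientGroup.ker_mk']
  | directedUnion K hdir htop _ ih => exact directedUnion K hdir htop ih

end ElementaryClass

theorem Group.IsVirtuallyNilpotent.of_finiteIndex {G : Type*} [Group G] {K : Subgroup G}
    (hK : K.FiniteIndex) (h : Group.IsVirtuallyNilpotent K) : Group.IsVirtuallyNilpotent G := by
  obtain ⟨N, hN, hfin⟩ := h
  refine ⟨N.map K.subtype, ?_, ⟨?_⟩⟩
  · exact (Group.isNilpotent_congr (N.equivMapOfInjective _ K.subtype_injective)).1 hN
  · rw [Subgroup.index_map_subtype]
    exact mul_ne_zero hfin.index_ne_zero hK.index_ne_zero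

theorem Subgroup.exists_injective_of_lowerCentralSeries_le {G E : Type*} [Group G] [Group E]
    {A K : Subgroup G} {M : Subgroup A} {f : A →* E} (hf : Function.Injective f) {N : Subgroup E}
    (hM : M ≤ N.comap f) {t : ℕ} (h : K.lowerCentralSeries t ≤ M.map A.subtype) :
    ∃ g : (⊤ : Subgroup K).lowerCentralSeries t →* N, Function.Injective g := by
  have hmem : ∀ x : (⊤ : Subgroup K).lowerCentralSeries t, ∃ m ∈ M, (m : G) = (x : K) := by
    intro x
    refine h ?_
    rw [← top_subtype_lowerCentralSeries]
    exact ⟨x, x.2, rfl⟩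
  let i : (⊤ : Subgroup K).lowerCentralSeries t →* A :=
    (K.subtype.comp (Subgroup.subtype _)).codRestrict A fun x => by
      obtain ⟨m, -, hm⟩ := hmem x
      have := m.2
      rwa [hm] at this
  refine ⟨(f.comp i).codRestrict N fun x => ?_, fun x y hxy => ?_⟩
  · obtain ⟨m, hm, hmx⟩ := hmem x
    have : i x = m := Subtype.ext hmx.symm
    exact (congrArg (· ∈ N) (congrArg f this)).mpr (hM hm)
  · have := hf (congrArg Subtype.val hxy)
    exact Subtype.ext (Subtype.ext (congrArg (fun a : A => (a : G)) this))

theorem ElementaryClass.isVirtuallyNilpotent {E : Type u} {inst : Group E}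
    (hE : ElementaryClass E inst) : ∀ {G : Type u} [Group G], HasSlowGenSets G → ∀ {s : ℕ}
      (f : (⊤ : Subgroup G).lowerCentralSeries s →* E), Function.Injective f →
        Group.IsVirtuallyNilpotent G := by
  induction hE with
  | trivial E h =>
    intro G _ _ s f hf
    have := hf.subsingleton
    exact (Subgroup.nilpotent_iff_lowerCentralSeries.2
      ⟨s, Subgroup.eq_bot_of_subsingleton _⟩).isVirtuallyNilpotent
  | abelianExtension N hN _ ih =>
    intro G _ hG s f hf
    obtain ⟨K, hK, t, ht⟩ := hG.exists_lowerCentralSeries_le_commutator s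
    obtain ⟨g, hg⟩ := Subgroup.exists_injective_of_lowerCentralSeries_le hf
      (commutator_le_comap f hN) ht
    exact .of_finiteIndex hK (ih (hG.subgroup K) g hg)
  | finiteExtension N hN _ ih =>
    intro G _ hG s f hf
    have : Group.FG ((⊤ : Subgroup G).lowerCentralSeries s) :=
      (Group.fg_iff_subgroup_fg _).2 (hG.fg_of_lowerCentralSeries_le le_rfl)
    have := Subgroup.finiteIndex_comap f hN
    obtain ⟨K, hK, h⟩ := Subgroup.exists_finiteIndex_commutator_le
      ((⊤ : Subgroup G).lowerCentralSeries s) (N.comap f)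
    have ht : K.lowerCentralSeries (s + 1) ≤ _ :=
      (Subgroup.commutator_mono (Subgroup.lowerCentralSeries_mono s le_top) le_rfl).trans h
    obtain ⟨g, hg⟩ := Subgroup.exists_injective_of_lowerCentralSeries_le hf le_rfl ht
    exact .of_finiteIndex hK (ih (hG.subgroup K) g hg)
  | @directedUnion E _ ι K hdir htop _ ih =>
    intro G _ hG s f hf
    cases isEmpty_or_nonempty ι with
    | inl _ =>
      have := subsingleton_of_iSup_eq_top htop
      have := hf.subsingleton
      exact (Subgroup.nilpotent_iff_lowerCentralSeries.2
        ⟨s, Subgroup.eq_bot_of_subsingleton _⟩).isVirtuallyNilpotent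
    | inr _ =>
      have : Group.FG ((⊤ : Subgroup G).lowerCentralSeries s) :=
        (Group.fg_iff_subgroup_fg _).2 (hG.fg_of_lowerCentralSeries_le le_rfl)
      obtain ⟨R, hR⟩ := (Group.fg_iff_subgroup_fg f.range).1 inferInstance
      choose i hi using fun x : E =>
        (Subgroup.mem_iSup_of_directed hdir).1 (htop ▸ Subgroup.mem_top x)
      classical
      obtain ⟨j, hj⟩ := hdir.finset_le (R.image i)
      have hrange : f.range ≤ K j := by
        rw [← hR, Subgroup.closure_le]
        exact fun x hx => hj (i x) (Finset.mem_image_of_mem i hx) (hi x)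
      refine ih j hG (f.codRestrict (K j) fun x => hrange ⟨x, rfl⟩) fun x y hxy => ?_
      exact hf (congrArg Subtype.val hxy)

theorem wordBall_eq_pow {G : Type*} [Group G] (X : Finset G) (n : ℕ) :
    wordBall X n = {x : G | x = 1 ∨ x ∈ X ∨ x⁻¹ ∈ X} ^ n := by
  induction n with
  | zero =>
    ext g
    simp only [wordBall, Nat.le_zero, List.length_eq_zero_iff, Set.mem_ofPred_eq, pow_zero,
      Set.mem_one]
    constructor
    · rintro ⟨l, rfl, -, rfl⟩
      rfl
    · rintro rfl
      exact ⟨[], rfl, by simp, rfl⟩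
  | succ n ih =>
    rw [pow_succ', ← ih]
    ext g
    constructor
    · rintro ⟨l, hl, hX, rfl⟩
      cases l with
      | nil => exact ⟨1, Or.inl rfl, 1, ⟨[], by simp, by simp, rfl⟩, by simp⟩
      | cons x l =>
        rw [List.forall_mem_cons] at hX
        exact ⟨x, Or.inr hX.1, l.prod, ⟨l, Nat.le_of_succ_le_succ hl, hX.2, rfl⟩, by simp⟩
    · rintro ⟨x, hx, _, ⟨l, hl, hX, rfl⟩, rfl⟩
      rcases hx with rfl | hx
      · exact ⟨l, hl.trans (Nat.le_succ n), hX, by simp⟩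
      · exact ⟨x :: l, Nat.succ_le_succ hl, List.forall_mem_cons.2 ⟨hx, hX⟩, by simp⟩

theorem HasSlowGenSets.of_minGrowthRate_eq_one {G : Type*} [Group G] (hfg : Group.FG G)
    (h : minGrowthRate G = 1) : HasSlowGenSets G := by
  intro k
  set r : ℝ := 2 ^ ((1 : ℝ) / (k + 1)) with hr
  have hk : (0 : ℝ) < k + 1 := by positivity
  have hr1 : 1 < r := Real.one_lt_rpow one_lt_two (by positivity)
  have hrk : r ^ (k + 1) = 2 := by
    rw [hr, ← Real.rpow_natCast, ← Real.rpow_mul zero_le_two]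
    push_cast
    rw [one_div_mul_cancel hk.ne', Real.rpow_one]
  obtain ⟨X₀, hX₀⟩ := Group.fg_def.1 hfg
  obtain ⟨_, ⟨X, hX, rfl⟩, hlt⟩ := exists_lt_of_csInf_lt
    (s := {r : ℝ | ∃ X : Finset G, Subgroup.closure (X : Set G) = ⊤ ∧ r = growthRateX X})
    ⟨_, X₀, hX₀, rfl⟩ (h.trans_lt hr1)
  obtain ⟨n, hn⟩ := exists_lt_of_ciInf_lt hlt
  have hgrowth : (growthFn X (n + 1) : ℝ) < r ^ (n + 1) := by
    have := Real.rpow_lt_rpow (by positivity) hn (show (0 : ℝ) < n + 1 by positivity)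
    rw [← Real.rpow_mul (by positivity), one_div_mul_cancel (by positivity), Real.rpow_one] at this
    exact_mod_cast this
  set S : Set G := {x : G | x = 1 ∨ x ∈ X ∨ x⁻¹ ∈ X} with hS
  refine ⟨S, IsSlowGenSet.mono (k := k + 1) ⟨?_, Or.inl rfl, ?_, ?_, n + 1, ?_⟩ (Nat.le_succ k)⟩
  · refine ((Set.finite_singleton (1 : G)).union
      (X.finite_toSet.union (X.finite_toSet.preimage inv_injective.injOn))).subset ?_
    exact fun x hx => hx
  · rintro x (rfl | hx | hx)
    · exact Or.inl inv_one
    · exact Or.inr (Or.inr (by rwa [inv_inv]))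
    · exact Or.inr (Or.inl hx)
  · rw [eq_top_iff, ← hX]
    exact Subgroup.closure_mono fun x hx => Or.inr (Or.inl hx)
  · have hle : (S ^ ((k + 1) * (n + 1))).ncard ≤ growthFn X (n + 1) ^ (k + 1) := by
      rw [growthFn, wordBall_eq_pow, mul_comm, pow_mul]
      induction k + 1 with
      | zero => simp [← Set.singleton_one]
      | succ k ih =>
        rw [pow_succ, pow_succ]
        exact Set.natCard_mul_le.trans (Nat.mul_le_mul_right _ ih)
    refine lt_of_le_of_lt hle ?_
    have := pow_lt_pow_left₀ hgrowth (by positivity) k.succ_ne_zero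
    rw [← pow_mul, mul_comm, pow_mul, hrk] at this
    exact_mod_cast this

/-- **Theorem 2.2 (Osin).** Let `G` be a finitely generated group of zero entropy
(`ω(G) = 1`) and `H` a normal subgroup of `G` such that `G/H` is elementary amenable.
Then `H` is finitely generated. -/
theorem normal_subgroup_fg_of_zero_entropy_of_elementaryAmenable_quotient
    {G : Type u} [inst : Group G] (hfg : Group.FG G) (hω : minGrowthRate G = 1)
    (H : Subgroup G) [H.Normal]
    (hEA : ElementaryAmenable (G ⧸ H) inferInstance) :
    H.FG := by
  have hG := HasSlowGenSets.of_minGrowthRate_eq_one hfg hω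
  obtain ⟨N, hN, hfin⟩ := hEA.elementaryClass.isVirtuallyNilpotent
    (hG.of_surjective (QuotientGroup.mk' H) (QuotientGroup.mk'_surjective H)) (s := 0)
    (Subgroup.subtype _) (Subgroup.subtype_injective _)
  obtain ⟨t, ht⟩ := Subgroup.nilpotent_iff_lowerCentralSeries.1 hN
  set K := N.comap (QuotientGroup.mk' H) with hK
  have := Subgroup.finiteIndex_comap (QuotientGroup.mk' H) hfin
  have hle : (⊤ : Subgroup K).lowerCentralSeries t ≤ H.subgroupOf K := by
    intro x hx
    have : _ ≤ (⊤ : Subgroup N).lowerCentralSeries t := Subgroup.lowerCentralSeries_mono t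
      (le_top (a := (⊤ : Subgroup K).map ((QuotientGroup.mk' H).subgroupComap N)))
    simp only [← Subgroup.map_lowerCentralSeries, ht] at this
    exact (QuotientGroup.eq_one_iff (x : G)).1
      (congrArg Subtype.val (Subgroup.mem_bot.1 (this ⟨x, hx, rfl⟩)))
  have hHK : H ≤ K := fun x hx => by
    rw [hK, Subgroup.mem_comap, QuotientGroup.mk'_apply, (QuotientGroup.eq_one_iff x).2 hx]
    exact one_mem N
  have hfgK := Subgroup.FG.map_hom ((hG.subgroup K).fg_of_lowerCentralSeries_le hle) K.subtype
  rwa [Subgroup.subgroupOf_map_subtype, inf_eq_left.2 hHK] at hfgK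
end

section
/- The number 1 is an accumulation point of the set Ω(EG) = {ω(G) : G a finitely generated elementary amenable group}: for every ε > 0 there exists a finitely generated elementary amenable group G of exponential growth with 1 < ω(G) < 1 + ε. -/
universe u

open Pointwise in
open scoped Classical in
/-- The letters `X ∪ X⁻¹` together with `1`. -/
noncomputable def symmLetters {G : Type*} [Group G] (X : Finset G) : Finset G :=
  insert 1 (X ∪ X⁻¹)

section Balls

open Pointwise
open scoped Classical

variable {G H : Type*} [Group G] [Group H]

lemma mem_symmLetters {X : Finset G} {x : G} :
    x ∈ symmLetters X ↔ x = 1 ∨ x ∈ X ∨ x⁻¹ ∈ X := by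
  simp [symmLetters]

lemma wordBall_eq_pow_s3 (X : Finset G) (n : ℕ) :
    wordBall X n = ((symmLetters X ^ n : Finset G) : Set G) := by
  ext g
  constructor
  · rintro ⟨l, hl, hX, rfl⟩
    have h1 : (1 : G) ∈ symmLetters X := mem_symmLetters.2 (Or.inl rfl)
    refine Finset.mem_coe.2 (Finset.pow_subset_pow_right h1 hl ?_)
    clear hl
    induction l with
    | nil => simp
    | cons x l ih =>
      rw [List.prod_cons, List.length_cons, pow_succ']
      exact Finset.mul_mem_mul (mem_symmLetters.2 (Or.inr (hX x (by simp))))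
        (ih fun y hy => hX y (by simp [hy]))
  · intro hg
    rw [Finset.mem_coe] at hg
    induction n generalizing g with
    | zero => exact ⟨[], by simp, by simp, (Finset.mem_one.1 hg).symm⟩
    | succ n ih =>
      rw [pow_succ'] at hg
      obtain ⟨x, hx, y, hy, rfl⟩ := Finset.mem_mul.1 hg
      obtain ⟨l, hl, hX, rfl⟩ := ih y hy
      rcases mem_symmLetters.1 hx with rfl | hx
      · exact ⟨l, by omega, hX, by simp⟩
      · exact ⟨x :: l, by simpa using hl, by simpa [hx] using hX, by simp⟩

lemma growthFn_eq_card_pow (X : Finset G) (n : ℕ) :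
    growthFn X n = (symmLetters X ^ n).card := by
  rw [growthFn, wordBall_eq_pow_s3, Nat.card_coe_set_eq, Set.ncard_coe_finset]

lemma growthFn_mul_le (X : Finset G) (k n : ℕ) : growthFn X (k * n) ≤ growthFn X n ^ k := by
  rw [growthFn_eq_card_pow, growthFn_eq_card_pow, mul_comm, pow_mul]
  exact Finset.card_pow_le

lemma growthFn_le_of_image_subset {f : H →* G} (hf : Function.Injective f) {X : Finset G}
    {Y : Finset H} {k : ℕ} (h : (symmLetters Y).image f ⊆ symmLetters X ^ k) (n : ℕ) :
    growthFn Y n ≤ growthFn X (k * n) := by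
  rw [growthFn_eq_card_pow, growthFn_eq_card_pow, pow_mul,
    ← Finset.card_image_of_injective _ hf, Finset.image_pow]
  exact Finset.card_le_card (Finset.pow_subset_pow_left h)

lemma one_le_growthFn (X : Finset G) (n : ℕ) : 1 ≤ growthFn X n := by
  rw [growthFn_eq_card_pow]
  exact Finset.card_pos.2 (Finset.Nonempty.pow ⟨1, mem_symmLetters.2 (Or.inl rfl)⟩)

lemma one_le_growthRateX (X : Finset G) : 1 ≤ growthRateX X :=
  le_ciInf fun n => Real.one_le_rpow (by exact_mod_cast one_le_growthFn X _) (by positivity)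

/-- The growth functions of `G` with respect to all finite generating sets dominate a common
exponential function. -/
def HasUniformExponentialGrowth (G : Type*) [Group G] : Prop :=
  ∃ c : ℝ, 1 < c ∧ ∀ X : Finset G, Subgroup.closure (X : Set G) = ⊤ →
    ∀ n : ℕ, c ^ n ≤ growthFn X n

lemma HasUniformExponentialGrowth.of_mul {c : ℝ} {k : ℕ} (hc : 1 < c) (hk : k ≠ 0)
    (h : ∀ X : Finset G, Subgroup.closure (X : Set G) = ⊤ → ∀ n : ℕ, c ^ n ≤ growthFn X (k * n)) :
    HasUniformExponentialGrowth G := by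
  have h0 : 0 ≤ c := by linarith
  refine ⟨c ^ ((k : ℝ)⁻¹), Real.one_lt_rpow hc (by positivity), fun X hX n => ?_⟩
  refine le_of_pow_le_pow_left₀ hk (by positivity) ?_
  rw [← pow_mul, mul_comm, pow_mul, Real.rpow_inv_natCast_pow h0 hk]
  exact (h X hX n).trans (by exact_mod_cast growthFn_mul_le X k n)

lemma HasUniformExponentialGrowth.of_surjective (f : H →* G) (hf : Function.Surjective f)
    (hG : HasUniformExponentialGrowth G) : HasUniformExponentialGrowth H := by
  obtain ⟨c, hc, h⟩ := hG
  refine ⟨c, hc, fun X hX n => ?_⟩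
  have hgen : Subgroup.closure ((X.image f : Finset G) : Set G) = ⊤ := by
    rw [Finset.coe_image, ← MonoidHom.map_closure, hX, ← MonoidHom.range_eq_map,
      MonoidHom.range_eq_top.2 hf]
  refine (h _ hgen n).trans ?_
  rw [growthFn_eq_card_pow, growthFn_eq_card_pow]
  have : symmLetters (X.image f) = (symmLetters X).image f := by
    simp [symmLetters, Finset.image_union, Finset.image_inv]
  rw [this, ← Finset.image_pow]
  exact_mod_cast Finset.card_image_le

lemma closure_letters_inter_ker {X : Finset G} (hX : Subgroup.closure (X : Set G) = ⊤)
    (s : G →* ℤˣ) :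
    s.ker ≤ Subgroup.closure (((symmLetters X ^ 3).filter (· ∈ s.ker) : Finset G) : Set G) := by
  set K := Subgroup.closure (((symmLetters X ^ 3).filter (· ∈ s.ker) : Finset G) : Set G) with hK
  have h1 : (1 : G) ∈ symmLetters X := mem_symmLetters.2 (Or.inl rfl)
  have hinv : ∀ x ∈ symmLetters X, x⁻¹ ∈ symmLetters X := fun x hx => by
    rw [mem_symmLetters] at hx ⊢
    rcases hx with rfl | hx | hx <;> simp [*]
  have hmem : ∀ x ∈ symmLetters X, ∀ y ∈ symmLetters X, ∀ z ∈ symmLetters X,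
      s (x * y * z) = 1 → x * y * z ∈ K := fun x hx y hy z hz h =>
    Subgroup.subset_closure (by
      rw [Finset.mem_coe, Finset.mem_filter]
      refine ⟨?_, h⟩
      rw [pow_succ, pow_two]
      exact Finset.mul_mem_mul (Finset.mul_mem_mul hx hy) hz)
  by_cases ht : ∃ t ∈ X, s t ≠ 1
  · obtain ⟨t, htX, ht⟩ := ht
    have ht : s t = -1 := (Int.units_eq_one_or _).resolve_left ht
    have htS : t ∈ symmLetters X := mem_symmLetters.2 (Or.inr (Or.inl htX))
    have key : ∀ k : G, (k ∈ K ∨ k * t⁻¹ ∈ K) → ∀ x ∈ symmLetters X,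
        (k * x ∈ K ∨ k * x * t⁻¹ ∈ K) := by
      intro k hk x hx
      rcases Int.units_eq_one_or (s x) with hs | hs <;> rcases hk with hk | hk
      · exact Or.inl (K.mul_mem hk (by simpa using hmem _ hx _ h1 _ h1 (by simp [hs])))
      · refine Or.inr ?_
        have := K.mul_mem hk (hmem _ htS _ hx _ (hinv _ htS) (by simp [hs]))
        simpa [mul_assoc] using this
      · refine Or.inr ?_
        have := K.mul_mem hk (hmem _ hx _ (hinv _ htS) _ h1 (by simp [hs, ht]))
        simpa [mul_assoc] using this
      · refine Or.inl ?_
        have := K.mul_mem hk (hmem _ htS _ hx _ h1 (by simp [hs, ht]))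
        simpa [mul_assoc] using this
    have all : ∀ g : G, g ∈ K ∨ g * t⁻¹ ∈ K := by
      intro g
      have hg : g ∈ Subgroup.closure (X : Set G) := hX ▸ Subgroup.mem_top g
      induction hg using Subgroup.closure_induction_right with
      | one => exact Or.inl K.one_mem
      | mul_right x hx y hy ih => exact key _ ih _ (mem_symmLetters.2 (Or.inr (Or.inl hy)))
      | mul_inv_cancel x hx y hy ih =>
        exact key _ ih _ (hinv _ (mem_symmLetters.2 (Or.inr (Or.inl hy))))
    intro g hg
    refine (all g).resolve_right fun h => ?_
    have hle : K ≤ s.ker := (Subgroup.closure_le _).2 fun y hy => by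
      rw [Finset.mem_coe, Finset.mem_filter] at hy
      exact hy.2
    have h2 := hle h
    rw [MonoidHom.mem_ker] at hg h2
    simp [hg, ht] at h2
  · push Not at ht
    have : Subgroup.closure (X : Set G) ≤ K := (Subgroup.closure_le _).2 fun x hx => by
      simpa using hmem x (mem_symmLetters.2 (Or.inr (Or.inl hx))) 1 h1 1 h1 (by simp [ht x hx])
    rw [hX] at this
    exact le_top.trans this

lemma HasUniformExponentialGrowth.of_ker (s : G →* ℤˣ)
    (hs : HasUniformExponentialGrowth s.ker) : HasUniformExponentialGrowth G := by
  obtain ⟨c, hc, h⟩ := hs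
  refine .of_mul hc three_ne_zero fun X hX n => ?_
  set Y : Finset s.ker := (symmLetters X ^ 3).subtype (· ∈ s.ker) with hY
  have hYimg : (Y.image (s.ker.subtype) : Finset G) = (symmLetters X ^ 3).filter (· ∈ s.ker) := by
    ext g
    simp [hY]
  have hgen : Subgroup.closure (Y : Set s.ker) = ⊤ := by
    apply Subgroup.map_injective s.ker.subtype_injective
    rw [MonoidHom.map_closure, ← Finset.coe_image, hYimg, ← MonoidHom.range_eq_map,
      Subgroup.range_subtype]
    refine le_antisymm ((Subgroup.closure_le _).2 fun y hy => ?_) (closure_letters_inter_ker hX s)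
    rw [Finset.mem_coe, Finset.mem_filter] at hy
    exact hy.2
  refine (h Y hgen n).trans ?_
  have h1 : (1 : G) ∈ symmLetters X := mem_symmLetters.2 (Or.inl rfl)
  have hinv : (symmLetters X)⁻¹ = symmLetters X := by
    ext x
    rw [Finset.mem_inv', mem_symmLetters, mem_symmLetters]
    simp [or_comm]
  have hsub : (symmLetters Y).image s.ker.subtype ⊆ symmLetters X ^ 3 := by
    intro g hg
    obtain ⟨y, hy, rfl⟩ := Finset.mem_image.1 hg
    rcases mem_symmLetters.1 hy with rfl | hy | hy
    · simpa using Finset.one_mem_pow h1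
    · simpa [hY] using hy
    · have : ((y : G))⁻¹ ∈ symmLetters X ^ 3 := by simpa [hY] using hy
      rw [← Finset.mem_inv', ← inv_pow, hinv] at this
      exact this
  exact_mod_cast growthFn_le_of_image_subset s.ker.subtype_injective hsub n

lemma HasUniformExponentialGrowth.exists_lt_growthRateX (h : HasUniformExponentialGrowth G) :
    ∃ c : ℝ, 1 < c ∧ ∀ X : Finset G, Subgroup.closure (X : Set G) = ⊤ → c ≤ growthRateX X := by
  obtain ⟨c, hc, h⟩ := h
  refine ⟨c, hc, fun X hX => le_ciInf fun n => ?_⟩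
  have h0 : 0 ≤ c := by linarith
  have := Real.rpow_le_rpow (by positivity) (h X hX (n + 1)) (by positivity : 0 ≤ (1 : ℝ) / (n + 1))
  refine le_of_eq_of_le ?_ this
  have h2 := Real.pow_rpow_inv_natCast h0 (Nat.succ_ne_zero n)
  rw [one_div]
  exact_mod_cast h2.symm

lemma minGrowthRate_le_growthRateX {X : Finset G} (hX : Subgroup.closure (X : Set G) = ⊤) :
    minGrowthRate G ≤ growthRateX X := by
  refine csInf_le ⟨1, ?_⟩ ⟨X, hX, rfl⟩
  rintro r ⟨Y, -, rfl⟩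
  exact one_le_growthRateX Y

lemma growthRateX_le_exp {X : Finset G} {C μ : ℝ}
    (h : ∀ n : ℕ, (growthFn X n : ℝ) ≤ C * Real.exp (μ * n)) : growthRateX X ≤ Real.exp μ := by
  have hC : 0 < C := by
    have h0 := h 0
    have h1 : (1 : ℝ) ≤ growthFn X 0 := by exact_mod_cast one_le_growthFn X 0
    simp at h0
    linarith
  have hle : ∀ n : ℕ, growthRateX X ≤ C ^ ((1 : ℝ) / (n + 1)) * Real.exp μ := by
    intro n
    have hbdd : BddBelow (Set.range fun n : ℕ =>
        (growthFn X (n + 1) : ℝ) ^ ((1 : ℝ) / (n + 1))) :=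
      ⟨0, by rintro _ ⟨m, rfl⟩; positivity⟩
    refine (ciInf_le hbdd n).trans ?_
    refine (Real.rpow_le_rpow (by positivity) (h (n + 1)) (by positivity)).trans_eq ?_
    rw [Real.mul_rpow hC.le (Real.exp_pos _).le, ← Real.exp_mul]
    congr 2
    push_cast
    field_simp
  have hlim : Filter.Tendsto (fun n : ℕ => C ^ ((1 : ℝ) / (n + 1)) * Real.exp μ) Filter.atTop
      (nhds (C ^ (0 : ℝ) * Real.exp μ)) :=
    ((Real.continuousAt_const_rpow hC.ne').tendsto.comp
      tendsto_one_div_add_atTop_nhds_zero_nat).mul_const _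
  rw [Real.rpow_zero, one_mul] at hlim
  exact ge_of_tendsto' hlim hle

end Balls

lemma ElementaryAmenable.of_ker {G H : Type u} [Group G] [Group H] (f : G →* H)
    (hker : ElementaryAmenable f.ker inferInstance) (hH : ElementaryAmenable H inferInstance) :
    ElementaryAmenable G inferInstance :=
  .extension f.ker hker (.subgroup (QuotientGroup.kerLift f) (QuotientGroup.kerLift_injective f) hH)

/-- The group of affine transformations `x ↦ ± 2 ^ k * x + t` of `ℚ`. -/
@[ext]
structure DyadicAffine where
  sign : ℤˣ
  exp : ℤ
  trans : ℚ

namespace DyadicAffine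

instance : Mul DyadicAffine :=
  ⟨fun f g => ⟨f.sign * g.sign, f.exp + g.exp, f.trans + (f.sign : ℤ) * 2 ^ f.exp * g.trans⟩⟩

instance : One DyadicAffine := ⟨⟨1, 0, 0⟩⟩

instance : Inv DyadicAffine :=
  ⟨fun f => ⟨f.sign, -f.exp, -((f.sign : ℤ) * 2 ^ (-f.exp) * f.trans)⟩⟩

@[simp] lemma mul_sign (f g : DyadicAffine) : (f * g).sign = f.sign * g.sign := rfl

@[simp] lemma mul_exp (f g : DyadicAffine) : (f * g).exp = f.exp + g.exp := rfl

@[simp] lemma mul_trans (f g : DyadicAffine) :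
    (f * g).trans = f.trans + (f.sign : ℤ) * 2 ^ f.exp * g.trans := rfl

@[simp] lemma one_sign : (1 : DyadicAffine).sign = 1 := rfl

@[simp] lemma one_exp : (1 : DyadicAffine).exp = 0 := rfl

@[simp] lemma one_trans : (1 : DyadicAffine).trans = 0 := rfl

instance : Group DyadicAffine := by
  refine Group.ofLeftAxioms (fun f g h => ?_) (fun f => ?_) (fun f => ?_)
  · ext
    · simp [mul_assoc]
    · simp [add_assoc]
    · simp [zpow_add₀ (two_ne_zero : (2 : ℚ) ≠ 0)]
      ring
  · ext <;> simp
  · ext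
    · exact congrArg _ (Int.units_mul_self f.sign)
    · exact neg_add_cancel f.exp
    · exact neg_add_cancel _

/-- The linear part of a dyadic affine transformation. -/
def linear : DyadicAffine →* ℤˣ × Multiplicative ℤ where
  toFun f := (f.sign, Multiplicative.ofAdd f.exp)
  map_one' := rfl
  map_mul' _ _ := rfl

lemma linear_eq_one_iff {f : DyadicAffine} : linear f = 1 ↔ f.sign = 1 ∧ f.exp = 0 := by
  rw [Prod.ext_iff]
  exact Iff.rfl

lemma elementaryAmenable : ElementaryAmenable DyadicAffine inferInstance := by
  refine .of_ker linear (.abelian _ fun f g => ?_) (.abelian _ mul_comm)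
  obtain ⟨f, hf⟩ := f
  obtain ⟨g, hg⟩ := g
  rw [MonoidHom.mem_ker, linear_eq_one_iff] at hf hg
  ext <;> simp [hf, hg, add_comm]

end DyadicAffine

open scoped Pointwise in
open scoped Classical in
lemma exists_mem_pow_sum_geom {H : Type*} [Group H] (f : H →* DyadicAffine) {S : Finset H}
    (hS : 1 ∈ S) {p v : H} (hp : p ∈ S ^ 2) (hv : v ∈ S ^ 4) {k : ℕ}
    (hp1 : (f p).sign = 1) (hpk : (f p).exp = k) (hv1 : (f v).sign = 1) (hvk : (f v).exp = 0)
    (n : ℕ) :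
    ∃ c : ℚ, ∀ s ⊆ Finset.range n, ∃ w ∈ S ^ (6 * n), (f w).sign = 1 ∧ (f w).exp = k * n ∧
      (f w).trans = c + (f v).trans * ∑ i ∈ s, ((2 : ℚ) ^ k) ^ i := by
  induction n with
  | zero =>
    refine ⟨0, fun s hs => ⟨1, by simp, by simp, by simp, ?_⟩⟩
    rw [Finset.subset_empty.1 hs]
    simp
  | succ n ih =>
    obtain ⟨c, hc⟩ := ih
    refine ⟨c + (2 ^ k) ^ n * (f p).trans, fun s hs => ?_⟩
    obtain ⟨w, hw, hw1, hwk, hwt⟩ := hc (s.erase n) fun i hi => by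
      have h1 := Finset.mem_range.1 (hs (Finset.mem_of_mem_erase hi))
      have h2 := Finset.ne_of_mem_erase hi
      exact Finset.mem_range.2 (by omega)
    have hpow : (2 : ℚ) ^ (k * n : ℤ) = (2 ^ k) ^ n := by
      rw [← pow_mul]
      exact_mod_cast zpow_natCast (2 : ℚ) (k * n)
    rw [show 6 * (n + 1) = 6 * n + 4 + 2 by ring, pow_add, pow_add]
    by_cases hn : n ∈ s
    · refine ⟨w * v * p, Finset.mul_mem_mul (Finset.mul_mem_mul hw hv) hp, ?_, ?_, ?_⟩
      · simp [hw1, hv1, hp1]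
      · simp [hwk, hvk, hpk]
        ring
      · rw [← Finset.add_sum_erase s _ hn]
        simp [hw1, hv1, hwk, hvk, hwt, hpow]
        ring
    · refine ⟨w * 1 * p,
        Finset.mul_mem_mul (Finset.mul_mem_mul hw (Finset.one_mem_pow hS)) hp, ?_, ?_, ?_⟩
      · simp [hw1, hp1]
      · simp [hwk, hpk]
        ring
      · rw [Finset.erase_eq_of_notMem hn] at hwt
        simp [hw1, hwk, hwt, hpow]
        ring

open scoped Pointwise in
open scoped Classical in
lemma HasUniformExponentialGrowth.of_dyadicAffine {H : Type*} [Group H] (f : H →* DyadicAffine)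
    (hexp : ∃ g, (f g).exp ≠ 0) (hcomm : ∃ g h, f g * f h ≠ f h * f g) :
    HasUniformExponentialGrowth H := by
  refine .of_mul (c := 2) (k := 6) one_lt_two (by norm_num) fun X hX n => ?_
  set S := symmLetters X with hSdef
  have hS : 1 ∈ S := mem_symmLetters.2 (Or.inl rfl)
  have hXS : ∀ x ∈ X, x ∈ S := fun x hx => mem_symmLetters.2 (Or.inr (Or.inl hx))
  have hXS' : ∀ x ∈ X, x⁻¹ ∈ S := fun x hx => mem_symmLetters.2 (Or.inr (Or.inr (by simpa)))
  have hx : ∃ x ∈ X, (f x).exp ≠ 0 := by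
    by_contra! hx
    obtain ⟨g, hg⟩ := hexp
    let e : H →* Multiplicative ℤ := (MonoidHom.snd _ _).comp (DyadicAffine.linear.comp f)
    have hle : Subgroup.closure (X : Set H) ≤ e.ker := (Subgroup.closure_le _).2 fun x hxX =>
      congrArg Multiplicative.ofAdd (hx x hxX)
    rw [hX] at hle
    exact hg (congrArg Multiplicative.toAdd (hle (Subgroup.mem_top g) : e g = 1))
  have hx' : ∃ x ∈ S, 0 < (f x).exp := by
    obtain ⟨x, hxX, hx⟩ := hx
    rcases lt_or_gt_of_ne hx with h | h
    · refine ⟨x⁻¹, hXS' x hxX, ?_⟩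
      rw [map_inv]
      change 0 < -(f x).exp
      omega
    · exact ⟨x, hXS x hxX, h⟩
  have hyz : ∃ y ∈ X, ∃ z ∈ X, f y * f z ≠ f z * f y := by
    by_contra! hyz
    obtain ⟨g, h, hgh⟩ := hcomm
    have hle1 : ∀ y ∈ X, ∀ z : H, f y * f z = f z * f y := fun y hy z => by
      have hle : Subgroup.closure (X : Set H) ≤ (Subgroup.centralizer {f y}).comap f :=
        (Subgroup.closure_le _).2 fun x hxX => by
          simpa [Subgroup.mem_centralizer_singleton_iff] using hyz x hxX y hy
      rw [hX] at hle
      have := hle (Subgroup.mem_top z)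
      rw [Subgroup.mem_comap, Subgroup.mem_centralizer_singleton_iff] at this
      exact this.symm
    have hle : Subgroup.closure (X : Set H) ≤ (Subgroup.centralizer {f h}).comap f :=
      (Subgroup.closure_le _).2 fun x hxX => by
        simpa [Subgroup.mem_centralizer_singleton_iff] using hle1 x hxX h
    rw [hX] at hle
    have := hle (Subgroup.mem_top g)
    rw [Subgroup.mem_comap, Subgroup.mem_centralizer_singleton_iff] at this
    exact hgh this
  obtain ⟨x, hxS, hx⟩ := hx'
  obtain ⟨y, hy, z, hz, hne⟩ := hyz
  have hv : y * z * y⁻¹ * z⁻¹ ∈ S ^ 4 := by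
    rw [pow_succ, pow_succ, pow_two]
    exact Finset.mul_mem_mul (Finset.mul_mem_mul (Finset.mul_mem_mul (hXS y hy) (hXS z hz))
      (hXS' y hy)) (hXS' z hz)
  have hp : x * x ∈ S ^ 2 := by
    rw [pow_two]
    exact Finset.mul_mem_mul hxS hxS
  obtain ⟨k, hk⟩ := Int.eq_ofNat_of_zero_le (by omega : 0 ≤ (f x).exp + (f x).exp)
  have hk2 : 2 ≤ k := by omega
  have hvlin : (f (y * z * y⁻¹ * z⁻¹)).sign = 1 ∧ (f (y * z * y⁻¹ * z⁻¹)).exp = 0 := by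
    rw [← DyadicAffine.linear_eq_one_iff]
    simp only [map_mul, map_inv]
    rw [mul_assoc, ← mul_inv_rev, mul_comm (DyadicAffine.linear (f z)), mul_inv_cancel]
  have hvt : (f (y * z * y⁻¹ * z⁻¹)).trans ≠ 0 := fun h0 => hne <| by
    have h1 : f (y * z * y⁻¹ * z⁻¹) = 1 := DyadicAffine.ext hvlin.1 hvlin.2 h0
    rw [map_mul, map_mul, map_mul, map_inv, map_inv, mul_inv_eq_one, mul_inv_eq_iff_eq_mul] at h1
    exact h1
  obtain ⟨c, hc⟩ := exists_mem_pow_sum_geom f hS hp hv (k := k)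
    (by rw [map_mul, DyadicAffine.mul_sign, Int.units_mul_self])
    (by rw [map_mul, DyadicAffine.mul_exp, hk]) hvlin.1 hvlin.2 n
  choose w hwS _ _ hwt using hc
  rw [growthFn_eq_card_pow]
  have hcard : (Finset.range n).powerset.card ≤ (S ^ (6 * n)).card := by
    refine Finset.card_le_card_of_forall_subsingleton
      (fun s g => ∃ hs : s ⊆ Finset.range n, w s hs = g)
      (fun s hs => ⟨w s (Finset.mem_powerset.1 hs), hwS _ _, _, rfl⟩) ?_
    rintro g - s ⟨-, hs, h1⟩ t ⟨-, ht, h2⟩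
    have h3 := hwt s hs
    rw [h1, ← h2, hwt t ht, add_right_inj, mul_right_inj' hvt] at h3
    refine (Finset.geomSum_injective (n := 2 ^ k) ?_ (by exact_mod_cast h3)).symm
    exact (by norm_num : 2 ≤ 2 ^ 1).trans (Nat.pow_le_pow_right two_pos (by omega))
  rw [Finset.card_powerset, Finset.card_range] at hcard
  exact_mod_cast hcard

/-- The wreath product of `G` with the group of order two. -/
@[ext]
structure Wreath2 (G : Type*) where
  left : G
  right : G
  swap : Bool

namespace Wreath2

variable {G : Type*} [Group G]

instance : Mul (Wreath2 G) :=
  ⟨fun g h => ⟨g.left * cond g.swap h.right h.left, g.right * cond g.swap h.left h.right,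
    g.swap ^^ h.swap⟩⟩

instance : One (Wreath2 G) := ⟨⟨1, 1, false⟩⟩

instance : Inv (Wreath2 G) :=
  ⟨fun g => ⟨cond g.swap g.right⁻¹ g.left⁻¹, cond g.swap g.left⁻¹ g.right⁻¹, g.swap⟩⟩

lemma mul_def (g h : Wreath2 G) : g * h = ⟨g.left * cond g.swap h.right h.left,
    g.right * cond g.swap h.left h.right, g.swap ^^ h.swap⟩ := rfl

lemma one_def : (1 : Wreath2 G) = ⟨1, 1, false⟩ := rfl

instance : Group (Wreath2 G) := by
  refine Group.ofLeftAxioms ?_ ?_ ?_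
  · rintro ⟨a, b, _ | _⟩ ⟨c, d, _ | _⟩ ⟨e, f, _ | _⟩ <;> simp [mul_def, mul_assoc]
  · rintro ⟨a, b, s⟩
    simp [mul_def, one_def]
  · rintro ⟨a, b, _ | _⟩
    · exact Wreath2.ext (inv_mul_cancel a) (inv_mul_cancel b) rfl
    · exact Wreath2.ext (inv_mul_cancel b) (inv_mul_cancel a) rfl

/-- The projection of the wreath product to the group of order two. -/
def sgn : Wreath2 G →* ℤˣ where
  toFun g := cond g.swap (-1) 1
  map_one' := rfl
  map_mul' := by
    rintro ⟨a, b, _ | _⟩ ⟨c, d, _ | _⟩ <;> simp [mul_def]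

lemma mem_ker_sgn {g : Wreath2 G} : g ∈ (sgn (G := G)).ker ↔ g.swap = false := by
  obtain ⟨a, b, _ | _⟩ := g
  · exact ⟨fun _ => rfl, fun _ => rfl⟩
  · exact ⟨fun h => absurd (show (-1 : ℤˣ) = 1 from h) (by decide), fun h => by simp at h⟩

/-- The action on the two copies of `G` of the elements which do not swap them. -/
def coords : (sgn (G := G)).ker →* G × G where
  toFun g := (g.1.left, g.1.right)
  map_one' := rfl
  map_mul' := by
    rintro ⟨g, hg⟩ ⟨h, hh⟩
    rw [mem_ker_sgn] at hg hh
    simp [mul_def, hg]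

lemma coords_injective : Function.Injective (coords (G := G)) := by
  rintro ⟨g, hg⟩ ⟨h, hh⟩ heq
  rw [mem_ker_sgn] at hg hh
  exact Subtype.ext (Wreath2.ext (congrArg Prod.fst heq) (congrArg Prod.snd heq) (hg.trans hh.symm))

lemma elementaryAmenable {G : Type u} [Group G] (hG : ElementaryAmenable G inferInstance) :
    ElementaryAmenable (Wreath2 G) inferInstance := by
  have hprod : ElementaryAmenable (G × G) inferInstance := by
    refine .of_ker (MonoidHom.fst G G) (.subgroup
      ((MonoidHom.snd G G).comp (MonoidHom.fst G G).ker.subtype) ?_ hG) hG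
    rintro ⟨⟨g, g'⟩, hg⟩ ⟨⟨h, h'⟩, hh⟩ heq
    exact Subtype.ext (Prod.ext ((hg : g = 1).trans (hh : h = 1).symm) heq)
  have hu : ElementaryAmenable (ULift.{u} ℤˣ) inferInstance := .finite _ inferInstance
  refine .of_ker (MulEquiv.ulift.symm.toMonoidHom.comp sgn) ?_ hu
  refine .subgroup (coords.comp (Subgroup.inclusion fun g hg => ?_)) ?_ hprod
  · exact congrArg ULift.down (hg : ULift.up (sgn g) = 1)
  · exact coords_injective.comp (Subgroup.inclusion_injective _)

/-- The first coordinate, on the elements of a subgroup which do not swap the coordinates. -/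
def leftCoord (K : Subgroup (Wreath2 G)) : (sgn.comp K.subtype).ker →* G :=
  (MonoidHom.fst G G).comp (coords.comp
    ((K.subtype.comp (sgn.comp K.subtype).ker.subtype).codRestrict _ fun g => g.2))

lemma mem_range_leftCoord {K : Subgroup (Wreath2 G)} {g h : G} (hg : ⟨g, h, false⟩ ∈ K) :
    g ∈ (leftCoord K).range :=
  ⟨⟨⟨_, hg⟩, rfl⟩, rfl⟩

end Wreath2

/-- An involution `a` together with a homomorphic image `{1, b, c, d}` of the Klein four-group. -/
structure KleinQuad (G : Type*) [Group G] where
  a : G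
  b : G
  c : G
  d : G
  a_mul_a : a * a = 1
  b_mul_b : b * b = 1
  c_mul_c : c * c = 1
  b_mul_c : b * c = d
  c_mul_b : c * b = d

namespace KleinQuad

section

variable {G H : Type*} [Group G] [Group H] (q : KleinQuad G)

lemma b_mul_d : q.b * q.d = q.c := by rw [← q.b_mul_c, ← mul_assoc, q.b_mul_b, one_mul]

lemma c_mul_d : q.c * q.d = q.b := by rw [← q.c_mul_b, ← mul_assoc, q.c_mul_c, one_mul]

lemma d_mul_b : q.d * q.b = q.c := by rw [← q.c_mul_b, mul_assoc, q.b_mul_b, mul_one]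

lemma d_mul_c : q.d * q.c = q.b := by rw [← q.b_mul_c, mul_assoc, q.c_mul_c, mul_one]

lemma d_mul_d : q.d * q.d = 1 := by
  nth_rewrite 1 [← q.b_mul_c]
  rw [mul_assoc, q.c_mul_d, q.b_mul_b]

/-- The set `{a, b, c, d}`. -/
def letters : Set G := {q.a, q.b, q.c, q.d}

/-- `q.WeightLE n g` says that `g` is a product of letters of total weight at most `n`,
where `a`, `b`, `c`, `d` have weights `3`, `3`, `2`, `1`. -/
inductive WeightLE : ℕ → G → Prop
  | one (n : ℕ) : WeightLE n 1
  | a {n : ℕ} {g : G} (h : WeightLE n g) : WeightLE (n + 3) (q.a * g)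
  | b {n : ℕ} {g : G} (h : WeightLE n g) : WeightLE (n + 3) (q.b * g)
  | c {n : ℕ} {g : G} (h : WeightLE n g) : WeightLE (n + 2) (q.c * g)
  | d {n : ℕ} {g : G} (h : WeightLE n g) : WeightLE (n + 1) (q.d * g)

/-- `q.Reduced i n g` says that `g` is the product of a word of weight `n` in which `a` alternates
with letters from `{b, c, d}`, and which, unless it is empty, starts with `a` exactly if `i`. -/
inductive Reduced : Bool → ℕ → G → Prop
  | one (i : Bool) : Reduced i 0 1
  | a {n : ℕ} {g : G} (h : Reduced false n g) : Reduced true (n + 3) (q.a * g)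
  | b {n : ℕ} {g : G} (h : Reduced true n g) : Reduced false (n + 3) (q.b * g)
  | c {n : ℕ} {g : G} (h : Reduced true n g) : Reduced false (n + 2) (q.c * g)
  | d {n : ℕ} {g : G} (h : Reduced true n g) : Reduced false (n + 1) (q.d * g)

variable {q}

lemma WeightLE.mono {m n : ℕ} {g : G} (h : q.WeightLE m g) (hmn : m ≤ n) : q.WeightLE n g := by
  induction h generalizing n with
  | one => exact .one n
  | a _ ih =>
    obtain ⟨k, rfl⟩ := Nat.exists_eq_add_of_le' (le_of_add_le_right hmn)
    exact .a (ih (by omega))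
  | b _ ih =>
    obtain ⟨k, rfl⟩ := Nat.exists_eq_add_of_le' (le_of_add_le_right hmn)
    exact .b (ih (by omega))
  | c _ ih =>
    obtain ⟨k, rfl⟩ := Nat.exists_eq_add_of_le' (le_of_add_le_right hmn)
    exact .c (ih (by omega))
  | d _ ih =>
    obtain ⟨k, rfl⟩ := Nat.exists_eq_add_of_le' (le_of_add_le_right hmn)
    exact .d (ih (by omega))

lemma Reduced.a_mul {i : Bool} {n : ℕ} {g : G} (h : q.Reduced i n g) :
    ∃ j, ∃ m ≤ n + 3, q.Reduced j m (q.a * g) := by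
  cases h with
  | one => exact ⟨_, _, le_rfl, .a (.one _)⟩
  | @a n _ h => exact ⟨_, n, by omega, by rwa [← mul_assoc, q.a_mul_a, one_mul]⟩
  | b h => exact ⟨_, _, le_rfl, .a (.b h)⟩
  | c h => exact ⟨_, _, le_rfl, .a (.c h)⟩
  | d h => exact ⟨_, _, le_rfl, .a (.d h)⟩

lemma Reduced.b_mul {i : Bool} {n : ℕ} {g : G} (h : q.Reduced i n g) :
    ∃ j, ∃ m ≤ n + 3, q.Reduced j m (q.b * g) := by
  cases h with
  | one => exact ⟨_, _, le_rfl, .b (.one _)⟩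
  | a h => exact ⟨_, _, le_rfl, .b (.a h)⟩
  | @b n _ h => exact ⟨_, n, by omega, by rwa [← mul_assoc, q.b_mul_b, one_mul]⟩
  | @c n _ h => exact ⟨_, n + 1, by omega, by rw [← mul_assoc, q.b_mul_c]; exact .d h⟩
  | @d n _ h => exact ⟨_, n + 2, by omega, by rw [← mul_assoc, q.b_mul_d]; exact .c h⟩

lemma Reduced.c_mul {i : Bool} {n : ℕ} {g : G} (h : q.Reduced i n g) :
    ∃ j, ∃ m ≤ n + 2, q.Reduced j m (q.c * g) := by
  cases h with
  | one => exact ⟨_, _, le_rfl, .c (.one _)⟩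
  | a h => exact ⟨_, _, le_rfl, .c (.a h)⟩
  | @b n _ h => exact ⟨_, n + 1, by omega, by rw [← mul_assoc, q.c_mul_b]; exact .d h⟩
  | @c n _ h => exact ⟨_, n, by omega, by rwa [← mul_assoc, q.c_mul_c, one_mul]⟩
  | @d n _ h => exact ⟨_, n + 3, by omega, by rw [← mul_assoc, q.c_mul_d]; exact .b h⟩

lemma Reduced.d_mul {i : Bool} {n : ℕ} {g : G} (h : q.Reduced i n g) :
    ∃ j, ∃ m ≤ n + 1, q.Reduced j m (q.d * g) := by
  cases h with
  | one => exact ⟨_, _, le_rfl, .d (.one _)⟩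
  | a h => exact ⟨_, _, le_rfl, .d (.a h)⟩
  | @b n _ h => exact ⟨_, n + 2, by omega, by rw [← mul_assoc, q.d_mul_b]; exact .c h⟩
  | @c n _ h => exact ⟨_, n + 3, by omega, by rw [← mul_assoc, q.d_mul_c]; exact .b h⟩
  | @d n _ h => exact ⟨_, n, by omega, by rwa [← mul_assoc, q.d_mul_d, one_mul]⟩

lemma WeightLE.exists_reduced {n : ℕ} {g : G} (h : q.WeightLE n g) :
    ∃ j, ∃ m ≤ n, q.Reduced j m g := by
  induction h with
  | one n => exact ⟨true, 0, n.zero_le, .one _⟩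
  | a _ ih =>
    obtain ⟨i, m, hm, h⟩ := ih
    obtain ⟨j, k, hk, h⟩ := h.a_mul
    exact ⟨j, k, by omega, h⟩
  | b _ ih =>
    obtain ⟨i, m, hm, h⟩ := ih
    obtain ⟨j, k, hk, h⟩ := h.b_mul
    exact ⟨j, k, by omega, h⟩
  | c _ ih =>
    obtain ⟨i, m, hm, h⟩ := ih
    obtain ⟨j, k, hk, h⟩ := h.c_mul
    exact ⟨j, k, by omega, h⟩
  | d _ ih =>
    obtain ⟨i, m, hm, h⟩ := ih
    obtain ⟨j, k, hk, h⟩ := h.d_mul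
    exact ⟨j, k, by omega, h⟩

variable (q)

/-- The set of products of letters of total weight at most `n`. -/
def weightBall (n : ℕ) : Set G := {g | q.WeightLE n g}

open scoped Pointwise in
open scoped Classical in
lemma weightBall_subset_pow (n : ℕ) :
    q.weightBall n ⊆ (({1, q.a, q.b, q.c, q.d} ^ n : Finset G) : Set G) := by
  intro g hg
  rw [Finset.mem_coe]
  have h1 : (1 : G) ∈ ({1, q.a, q.b, q.c, q.d} : Finset G) := by simp
  have key : ∀ {m n : ℕ} {x g : G}, x ∈ ({1, q.a, q.b, q.c, q.d} : Finset G) → m + 1 ≤ n →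
      g ∈ ({1, q.a, q.b, q.c, q.d} ^ m : Finset G) →
      x * g ∈ ({1, q.a, q.b, q.c, q.d} ^ n : Finset G) := fun hx hmn hg => by
    refine Finset.pow_subset_pow_right h1 hmn ?_
    rw [pow_succ']
    exact Finset.mul_mem_mul hx hg
  induction hg with
  | one n => exact Finset.one_mem_pow h1
  | a _ ih => exact key (by simp) (by omega) ih
  | b _ ih => exact key (by simp) (by omega) ih
  | c _ ih => exact key (by simp) (by omega) ih
  | d _ ih => exact key (by simp) (by omega) ih

lemma finite_weightBall (n : ℕ) : (q.weightBall n).Finite := by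
  classical exact (Finset.finite_toSet _).subset (q.weightBall_subset_pow n)

lemma ncard_weightBall_le_pow (n : ℕ) : (q.weightBall n).ncard ≤ 5 ^ n := by
  classical
  refine (Set.ncard_le_ncard (q.weightBall_subset_pow n) (Finset.finite_toSet _)).trans ?_
  rw [Set.ncard_coe_finset]
  exact Finset.card_pow_le.trans (Nat.pow_le_pow_left Finset.card_le_five n)

lemma growthFn_le_ncard_weightBall {X : Finset G} (hX : (X : Set G) = q.letters) (n : ℕ) :
    growthFn X n ≤ (q.weightBall (3 * n)).ncard := by
  rw [growthFn, Nat.card_coe_set_eq]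
  refine Set.ncard_le_ncard ?_ (q.finite_weightBall _)
  have hinv : ∀ x : G, x⁻¹ ∈ q.letters → x ∈ q.letters := by
    intro x hx
    rw [letters, Set.mem_insert_iff, Set.mem_insert_iff, Set.mem_insert_iff,
      Set.mem_singleton_iff] at hx
    rcases hx with h | h | h | h <;> rw [inv_eq_iff_eq_inv] at h
    · rw [h, inv_eq_of_mul_eq_one_left q.a_mul_a]
      simp [letters]
    · rw [h, inv_eq_of_mul_eq_one_left q.b_mul_b]
      simp [letters]
    · rw [h, inv_eq_of_mul_eq_one_left q.c_mul_c]
      simp [letters]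
    · rw [h, inv_eq_of_mul_eq_one_left q.d_mul_d]
      simp [letters]
  rintro _ ⟨l, hl, hlX, rfl⟩
  refine WeightLE.mono (m := 3 * l.length) ?_ (by omega)
  clear hl
  induction l with
  | nil => exact .one _
  | cons x l ih =>
    have ih := ih fun y hy => hlX y (by simp [hy])
    have hx : x ∈ q.letters := by
      have := hlX x (by simp)
      rw [← Finset.mem_coe, ← Finset.mem_coe, hX] at this
      exact this.elim id (hinv x)
    rw [List.prod_cons, List.length_cons]
    rcases hx with rfl | rfl | rfl | rfl
    · exact ih.a
    · exact ih.b
    · exact (ih.c).mono (by omega)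
    · exact (ih.d).mono (by omega)

/-- The quadruple `q`, viewed in the subgroup it generates. -/
def restrict : KleinQuad (Subgroup.closure q.letters) where
  a := ⟨q.a, Subgroup.subset_closure (by simp [letters])⟩
  b := ⟨q.b, Subgroup.subset_closure (by simp [letters])⟩
  c := ⟨q.c, Subgroup.subset_closure (by simp [letters])⟩
  d := ⟨q.d, Subgroup.subset_closure (by simp [letters])⟩
  a_mul_a := Subtype.ext q.a_mul_a
  b_mul_b := Subtype.ext q.b_mul_b
  c_mul_c := Subtype.ext q.c_mul_c
  b_mul_c := Subtype.ext q.b_mul_c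
  c_mul_b := Subtype.ext q.c_mul_b

lemma closure_restrict_letters : Subgroup.closure q.restrict.letters = ⊤ := by
  rw [← Subgroup.closure_closure_coe_preimage (k := q.letters)]
  congr 1
  ext g
  exact or_congr Subtype.ext_iff (or_congr Subtype.ext_iff
    (or_congr Subtype.ext_iff Subtype.ext_iff))

lemma WeightLE.of_restrict {n : ℕ} {g : Subgroup.closure q.letters}
    (h : q.restrict.WeightLE n g) : q.WeightLE n g := by
  induction h with
  | one n => exact .one n
  | a _ ih => exact ih.a
  | b _ ih => exact ih.b
  | c _ ih => exact ih.c
  | d _ ih => exact ih.d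

lemma ncard_weightBall_restrict_le (n : ℕ) :
    (q.restrict.weightBall n).ncard ≤ (q.weightBall n).ncard :=
  Set.ncard_le_ncard_of_injOn Subtype.val (fun _ hg => WeightLE.of_restrict q hg)
    Subtype.val_injective.injOn (q.finite_weightBall n)

/-- The quadruple in the wreath product defined by the recursion of Grigorchuk's group:
`a` swaps the coordinates, `b = (a, c)`, `c = (a, d)` and `d = (1, b)`. -/
def lift : KleinQuad (Wreath2 G) where
  a := ⟨1, 1, true⟩
  b := ⟨q.a, q.c, false⟩
  c := ⟨q.a, q.d, false⟩
  d := ⟨1, q.b, false⟩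
  a_mul_a := by simp [Wreath2.mul_def, Wreath2.one_def]
  b_mul_b := by simp [Wreath2.mul_def, Wreath2.one_def, q.a_mul_a, q.c_mul_c]
  c_mul_c := by simp [Wreath2.mul_def, Wreath2.one_def, q.a_mul_a, q.d_mul_d]
  b_mul_c := by simp [Wreath2.mul_def, q.a_mul_a, q.c_mul_d]
  c_mul_b := by simp [Wreath2.mul_def, q.a_mul_a, q.d_mul_c]

variable {q}

lemma Reduced.weightLE_coords {i : Bool} {n : ℕ} {g : Wreath2 G} (h : q.lift.Reduced i n g) :
    ∃ u v, q.WeightLE u g.left ∧ q.WeightLE v g.right ∧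
      6 * (u + v) + cond i 15 0 ≤ 5 * n + 15 := by
  induction h with
  | one i => exact ⟨0, 0, .one _, .one _, by cases i <;> simp⟩
  | @a n g _ ih =>
    obtain ⟨u, v, hu, hv, h⟩ := ih
    refine ⟨v, u, ?_, ?_, ?_⟩
    · simpa [Wreath2.mul_def, lift] using hv
    · simpa [Wreath2.mul_def, lift] using hu
    · simp at h ⊢
      omega
  | b _ ih =>
    obtain ⟨u, v, hu, hv, h⟩ := ih
    exact ⟨_, _, hu.a, hv.c, by simp at h ⊢; omega⟩
  | c _ ih =>
    obtain ⟨u, v, hu, hv, h⟩ := ih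
    exact ⟨_, _, hu.a, hv.d, by simp at h ⊢; omega⟩
  | d _ ih =>
    obtain ⟨u, v, hu, hv, h⟩ := ih
    refine ⟨u, v + 3, ?_, hv.b, by simp at h ⊢; omega⟩
    simpa [Wreath2.mul_def, lift] using hu

lemma WeightLE.coords {n : ℕ} {g : Wreath2 G} (h : q.lift.WeightLE n g) :
    ∃ i ≤ (5 * n + 15) / 6, q.WeightLE i g.left ∧ q.WeightLE ((5 * n + 15) / 6 - i) g.right := by
  obtain ⟨j, m, hm, h⟩ := h.exists_reduced
  obtain ⟨u, v, hu, hv, huv⟩ := h.weightLE_coords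
  exact ⟨u, by omega, hu, hv.mono (by omega)⟩

variable (q)

lemma ncard_weightBall_lift_le (n : ℕ) :
    (q.lift.weightBall n).ncard ≤ ∑ i ∈ Finset.range ((5 * n + 15) / 6 + 1),
      2 * ((q.weightBall i).ncard * (q.weightBall ((5 * n + 15) / 6 - i)).ncard) := by
  let B : ℕ → Set (Wreath2 G) := fun i =>
    (fun p : G × G × Bool => ⟨p.1, p.2.1, p.2.2⟩) ''
      (q.weightBall i ×ˢ q.weightBall ((5 * n + 15) / 6 - i) ×ˢ Set.univ)
  have hfin : ∀ i, (q.weightBall i ×ˢ q.weightBall ((5 * n + 15) / 6 - i) ×ˢ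
      (Set.univ : Set Bool)).Finite := fun i =>
    (q.finite_weightBall _).prod ((q.finite_weightBall _).prod Set.finite_univ)
  have hsub : q.lift.weightBall n ⊆ ⋃ i ∈ Finset.range ((5 * n + 15) / 6 + 1), B i := by
    intro g hg
    obtain ⟨i, hi, hl, hr⟩ := WeightLE.coords hg
    simp only [Set.mem_iUnion]
    exact ⟨i, Finset.mem_range.2 (by omega), (g.left, g.right, g.swap),
      ⟨hl, hr, Set.mem_univ _⟩, rfl⟩
  refine (Set.ncard_le_ncard hsub (Set.Finite.biUnion (Finset.finite_toSet _)
    fun i _ => (hfin i).image _)).trans ?_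
  refine (Finset.set_ncard_biUnion_le _ _).trans (Finset.sum_le_sum fun i _ => ?_)
  refine (Set.ncard_image_le (hfin i)).trans_eq ?_
  rw [Set.ncard_prod, Set.ncard_prod, Set.ncard_univ, Nat.card_eq_fintype_card, Fintype.card_bool]
  ring

lemma exists_ncard_weightBall_lift_le_exp {C μ : ℝ} (hμ : 0 < μ)
    (h : ∀ n : ℕ, ((q.weightBall n).ncard : ℝ) ≤ C * Real.exp (μ * n)) :
    ∃ C' : ℝ, ∀ n : ℕ,
      ((q.lift.weightBall n).ncard : ℝ) ≤ C' * Real.exp (6 / 7 * μ * n) := by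
  refine ⟨2 * C ^ 2 * (42 / μ + 4) * Real.exp (5 / 2 * μ), fun n => ?_⟩
  set m := (5 * n + 15) / 6 with hm
  have hmn : (m : ℝ) ≤ 5 / 6 * n + 5 / 2 := by
    have : 6 * m ≤ 5 * n + 15 := by omega
    have : (6 : ℝ) * m ≤ 5 * n + 15 := by exact_mod_cast this
    linarith
  have hexp : (m + 1 : ℝ) ≤ (42 / μ + 4) * Real.exp (1 / 42 * μ * n) := by
    have h1 := Real.add_one_le_exp (1 / 42 * μ * n)
    have h2 : (m + 1 : ℝ) ≤ (42 / μ + 4) * (1 / 42 * μ * n + 1) := by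
      have h3 : (42 / μ + 4) * (1 / 42 * μ * n + 1) =
          n + 42 / μ + 4 * (1 / 42 * μ * n) + 4 := by
        field_simp
        ring
      have h4 : 0 ≤ 42 / μ := by positivity
      have h5 : 0 ≤ 1 / 42 * μ * n := by positivity
      have h6 : (0 : ℝ) ≤ n := by positivity
      rw [h3]
      linarith
    exact h2.trans (mul_le_mul_of_nonneg_left h1 (by positivity))
  have hC : 0 ≤ C := by
    have h0 := (Nat.cast_nonneg _).trans (h 0)
    simpa using h0
  calc ((q.lift.weightBall n).ncard : ℝ)
      ≤ ∑ i ∈ Finset.range (m + 1),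
          2 * ((q.weightBall i).ncard * (q.weightBall (m - i)).ncard : ℝ) := by
        exact_mod_cast q.ncard_weightBall_lift_le n
    _ ≤ ∑ i ∈ Finset.range (m + 1), 2 * (C ^ 2 * Real.exp (μ * m)) := by
        refine Finset.sum_le_sum fun i hi => ?_
        have hi : i ≤ m := by
          rw [Finset.mem_range] at hi
          omega
        have h1 := mul_le_mul (h i) (h (m - i)) (Nat.cast_nonneg _) (by positivity)
        have h2 : C * Real.exp (μ * i) * (C * Real.exp (μ * (m - i : ℕ))) =
            C ^ 2 * Real.exp (μ * m) := by
          rw [mul_mul_mul_comm, ← Real.exp_add, ← mul_add, Nat.cast_sub hi, ← pow_two]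
          congr 3
          ring
        linarith
    _ = (m + 1) * (2 * (C ^ 2 * Real.exp (μ * m))) := by
        rw [Finset.sum_const, Finset.card_range, nsmul_eq_mul]
        push_cast
        ring
    _ ≤ ((42 / μ + 4) * Real.exp (1 / 42 * μ * n)) *
          (2 * (C ^ 2 * (Real.exp (5 / 2 * μ) * Real.exp (5 / 6 * μ * n)))) := by
        have h1 : Real.exp (μ * m) ≤ Real.exp (5 / 2 * μ) * Real.exp (5 / 6 * μ * n) := by
          rw [← Real.exp_add, Real.exp_le_exp]
          nlinarith
        gcongr
    _ = 2 * C ^ 2 * (42 / μ + 4) * Real.exp (5 / 2 * μ) * Real.exp (6 / 7 * μ * n) := by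
        have h1 : Real.exp (6 / 7 * μ * n) =
            Real.exp (1 / 42 * μ * n) * Real.exp (5 / 6 * μ * n) := by
          rw [← Real.exp_add]
          congr 1
          ring
        rw [h1]
        ring

lemma hasUniformExponentialGrowth_closure_lift (hq : Subgroup.closure q.letters = ⊤)
    (hG : HasUniformExponentialGrowth G) :
    HasUniformExponentialGrowth (Subgroup.closure q.lift.letters) := by
  set K := Subgroup.closure q.lift.letters with hK
  have ha : q.lift.a ∈ K := Subgroup.subset_closure (by simp [letters])
  have hb : q.lift.b ∈ K := Subgroup.subset_closure (by simp [letters])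
  have hc : q.lift.c ∈ K := Subgroup.subset_closure (by simp [letters])
  have hd : q.lift.d ∈ K := Subgroup.subset_closure (by simp [letters])
  have hconj : ∀ {g h : G}, ⟨g, h, false⟩ ∈ K → h ∈ (Wreath2.leftCoord K).range := by
    intro g h hgh
    refine Wreath2.mem_range_leftCoord (h := g) ?_
    have := K.mul_mem (K.mul_mem ha hgh) ha
    simpa [Wreath2.mul_def, lift] using this
  have hrange : (Wreath2.leftCoord K).range = ⊤ := by
    rw [eq_top_iff, ← hq, Subgroup.closure_le]
    rintro x (rfl | rfl | rfl | rfl)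
    · exact Wreath2.mem_range_leftCoord hb
    · exact hconj hd
    · exact hconj hb
    · exact hconj hc
  exact .of_ker _ (.of_surjective _ (MonoidHom.range_eq_top.1 hrange) hG)

end

/-- Four elements generating a subgroup of the wreath product of `DyadicAffine` with the group of
order two; the product of `a` and `b` acts on the coordinates by `x ↦ 2 * x` and `x ↦ x / 2`. -/
def dyadic : KleinQuad (Wreath2 DyadicAffine) where
  a := ⟨1, 1, true⟩
  b := ⟨⟨1, 1, 0⟩, ⟨1, -1, 0⟩, true⟩
  c := ⟨⟨-1, 1, 2⟩, ⟨-1, -1, 1⟩, true⟩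
  d := ⟨⟨-1, 0, 2⟩, ⟨-1, 0, 1⟩, false⟩
  a_mul_a := by simp [Wreath2.mul_def, Wreath2.one_def]
  b_mul_b := by ext <;> simp [Wreath2.mul_def, Wreath2.one_def]
  c_mul_c := by ext <;> simp [Wreath2.mul_def, Wreath2.one_def]
  b_mul_c := by ext <;> simp [Wreath2.mul_def]
  c_mul_b := by ext <;> simp [Wreath2.mul_def]

lemma hasUniformExponentialGrowth_closure_dyadic :
    HasUniformExponentialGrowth (Subgroup.closure dyadic.letters) := by
  set K := Subgroup.closure dyadic.letters with hK
  have ha : dyadic.a ∈ K := Subgroup.subset_closure (by simp [letters])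
  have hb : dyadic.b ∈ K := Subgroup.subset_closure (by simp [letters])
  have hd : dyadic.d ∈ K := Subgroup.subset_closure (by simp [letters])
  obtain ⟨x, hx⟩ : (⟨1, 1, 0⟩ : DyadicAffine) ∈ (Wreath2.leftCoord K).range := by
    refine Wreath2.mem_range_leftCoord (h := ⟨1, -1, 0⟩) ?_
    have := K.mul_mem hb ha
    simpa [Wreath2.mul_def, dyadic] using this
  obtain ⟨y, hy⟩ : (⟨-1, 0, 2⟩ : DyadicAffine) ∈ (Wreath2.leftCoord K).range :=
    Wreath2.mem_range_leftCoord hd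
  refine .of_ker _ (.of_dyadicAffine (Wreath2.leftCoord K) ⟨x, ?_⟩ ⟨x, y, ?_⟩)
  · rw [hx]
    exact one_ne_zero
  · rw [hx, hy, Ne, DyadicAffine.ext_iff]
    simp

end KleinQuad

/-- There is an elementary amenable group of uniformly exponential growth, generated by a
`KleinQuad` whose weighted balls of radius `n` have at most `C * exp (μ * n)` elements. -/
def HasQuadOfRate (μ : ℝ) : Prop :=
  ∃ (G : Type) (_ : Group G) (q : KleinQuad G) (C : ℝ), Subgroup.closure q.letters = ⊤ ∧
    ElementaryAmenable G inferInstance ∧ HasUniformExponentialGrowth G ∧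
    ∀ n : ℕ, ((q.weightBall n).ncard : ℝ) ≤ C * Real.exp (μ * n)

lemma hasQuadOfRate_log_five : HasQuadOfRate (Real.log 5) := by
  refine ⟨_, _, KleinQuad.dyadic.restrict, 1, KleinQuad.closure_restrict_letters _,
    .subgroup (Subgroup.subtype _) (Subgroup.subtype_injective _)
      (Wreath2.elementaryAmenable DyadicAffine.elementaryAmenable),
    KleinQuad.hasUniformExponentialGrowth_closure_dyadic, fun n => ?_⟩
  rw [one_mul, Real.exp_mul, Real.exp_log (by norm_num), Real.rpow_natCast]
  exact_mod_cast KleinQuad.ncard_weightBall_le_pow _ n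

lemma HasQuadOfRate.lift {μ : ℝ} (hμ : 0 < μ) (h : HasQuadOfRate μ) :
    HasQuadOfRate (6 / 7 * μ) := by
  obtain ⟨G, _, q, C, hq, hEA, hG, hC⟩ := h
  obtain ⟨C', hC'⟩ := q.exists_ncard_weightBall_lift_le_exp hμ hC
  refine ⟨_, _, q.lift.restrict, C', KleinQuad.closure_restrict_letters _,
    .subgroup (Subgroup.subtype _) (Subgroup.subtype_injective _)
      (Wreath2.elementaryAmenable hEA),
    q.hasUniformExponentialGrowth_closure_lift hq hG, fun n => (hC' n).trans' ?_⟩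
  exact_mod_cast q.lift.ncard_weightBall_restrict_le n

lemma hasQuadOfRate_pow_mul_log_five (k : ℕ) : HasQuadOfRate ((6 / 7) ^ k * Real.log 5) := by
  have hlog : 0 < Real.log 5 := Real.log_pos (by norm_num)
  induction k with
  | zero => simpa using hasQuadOfRate_log_five
  | succ k ih =>
    rw [pow_succ', mul_assoc]
    exact ih.lift (by positivity)

/-- **Theorem 2.3 (Osin).** `1` is an accumulation point of `Ω(EG) = {ω(G) : G ∈ EG f.g.}`:
for every `ε > 0` there is a finitely generated elementary amenable group `G` of
exponential growth with `1 < ω(G) < 1 + ε`. -/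
theorem one_accumulation_point_of_elementaryAmenable_growth_rates :
    ∀ ε : ℝ, 0 < ε →
      ∃ (G : Type) (inst : Group G), Group.FG G ∧ ElementaryAmenable G inst ∧
        HasExponentialGrowth G ∧ 1 < minGrowthRate G ∧ minGrowthRate G < 1 + ε := by
  intro ε hε
  have hlim : Filter.Tendsto (fun k : ℕ => Real.exp (3 * ((6 / 7) ^ k * Real.log 5))) Filter.atTop
      (nhds (Real.exp (3 * (0 * Real.log 5)))) :=
    (Real.continuous_exp.tendsto _).comp (((tendsto_pow_atTop_nhds_zero_of_lt_one
      (by norm_num) (by norm_num)).mul_const _).const_mul _)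
  rw [zero_mul, mul_zero, Real.exp_zero] at hlim
  obtain ⟨k, hk⟩ := (hlim.eventually_lt_const (by linarith : 1 < 1 + ε)).exists
  obtain ⟨G, inst, q, C, hq, hEA, hG, hC⟩ := hasQuadOfRate_pow_mul_log_five k
  obtain ⟨c, hc, hlow⟩ := hG.exists_lt_growthRateX
  have hfin : q.letters.Finite := by simp [KleinQuad.letters]
  obtain ⟨X, hX⟩ := hfin.exists_finset_coe
  have hgen : Subgroup.closure (X : Set G) = ⊤ := by rw [hX, hq]
  refine ⟨G, inst, ⟨X, hgen⟩, hEA, ⟨X, hgen, hc.trans_le (hlow X hgen)⟩, ?_, ?_⟩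
  · refine hc.trans_le (le_csInf ⟨_, X, hgen, rfl⟩ ?_)
    rintro r ⟨Y, hY, rfl⟩
    exact hlow Y hY
  · refine ((minGrowthRate_le_growthRateX hgen).trans
      (growthRateX_le_exp (C := C) fun n => ?_)).trans_lt hk
    refine (Nat.cast_le.2 (q.growthFn_le_ncard_weightBall hX n)).trans ((hC (3 * n)).trans_eq ?_)
    congr 2
    push_cast
    ring
end
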